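/- Let d ≥ 2 and σ > 0. There exist constants c > 0 and C = C(d, σ) with the following property. Let S ⊂ [0,1]^{d+1} be a semi-algebraic set of degree at most B (B ≥ 2) with mes_{d+1} S < e^{−B^σ}, and let M be an integer satisfying B ≤ M^{1/C} and log M ≤ B^{σ/C}. Then for every x ∈ 𝕋^d, the set { ω ∈ [0,1] : there exists an integer j with M ≤ j ≤ 2M such that (ω, T_ω^j x) ∈ S } has Lebesgue measure less than M^{−c}, where T_ω is the skew shift on 𝕋^d with frequency ω and (ω, T_ω^j x) is viewed as a point of [0,1]^{d+1} via representatives in [0,1). -/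

import Mathlib

open MeasureTheory

noncomputable section

/-- The circle `ℝ/ℤ`. -/
abbrev 𝕋 : Type := AddCircle (1 : ℝ)

/-- The skew shift `T_ω : 𝕋^d → 𝕋^d`: `(Tx)_i = x_i + x_{i+1}` for `i < d - 1` and
`(Tx)_{d-1} = x_{d-1} + ω` (0-indexed coordinates `i : Fin d`). -/
def skewShift (d : ℕ) (ω : ℝ) (x : Fin d → 𝕋) : Fin d → 𝕋 := fun i =>
  if h : (i : ℕ) + 1 < d then x i + x ⟨(i : ℕ) + 1, h⟩ else x i + (ω : 𝕋)

/-- The representative in `[0,1)` of a point of `𝕋`. -/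
def rep (y : 𝕋) : ℝ := ((AddCircle.equivIco 1 0) y : ℝ)

/-- A basic cell of a semi-algebraic set: the sign conditions `0, 1, 2 : Fin 3` encode
`P(x) ≤ 0`, `P(x) = 0`, `P(x) ≥ 0` respectively. -/
def SAcell {n s : ℕ} (P : Fin s → MvPolynomial (Fin n) ℝ)
    (c : Finset (Fin s) × (Fin s → Fin 3)) : Set (Fin n → ℝ) :=
  {x | ∀ l ∈ c.1,
      (c.2 l = 0 → MvPolynomial.eval x (P l) ≤ 0) ∧
      (c.2 l = 1 → MvPolynomial.eval x (P l) = 0) ∧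
      (c.2 l = 2 → 0 ≤ MvPolynomial.eval x (P l))}

/-- `S ⊆ ℝⁿ` is semi-algebraic of degree at most `B`. -/
def IsSemialgebraic (n : ℕ) (B : ℝ) (S : Set (Fin n → ℝ)) : Prop :=
  ∃ (s d₀ : ℕ) (P : Fin s → MvPolynomial (Fin n) ℝ)
    (𝒞 : Finset (Finset (Fin s) × (Fin s → Fin 3))),
      (∀ i, (P i).totalDegree ≤ d₀) ∧ ((s : ℝ) * (d₀ : ℝ) ≤ B) ∧
      S = ⋃ cc ∈ 𝒞, SAcell P cc

/-- `X ⊆ ℝⁿ` is determined by the weak signs of finitely many polynomials of total degree `≤ B`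
altogether. -/
def SignClosed (n B : ℕ) (X : Set (Fin n → ℝ)) : Prop :=
  ∃ (ι : Type) (_ : Fintype ι) (P : ι → MvPolynomial (Fin n) ℝ),
    ∑ l, (P l).totalDegree ≤ B ∧ ∀ x ∈ X, ∀ y,
      (∀ l, (0 ≤ MvPolynomial.eval x (P l) → 0 ≤ MvPolynomial.eval y (P l)) ∧
        (MvPolynomial.eval x (P l) ≤ 0 → MvPolynomial.eval y (P l) ≤ 0)) → y ∈ X

theorem totalDegree_aeval_le {m n e : ℕ} (f : Fin m → MvPolynomial (Fin n) ℝ)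
    (hf : ∀ i, (f i).totalDegree ≤ e) (p : MvPolynomial (Fin m) ℝ) :
    (MvPolynomial.aeval f p).totalDegree ≤ e * p.totalDegree := by
  rw [MvPolynomial.aeval_def, MvPolynomial.eval₂_eq']
  refine MvPolynomial.totalDegree_finsetSum_le fun s hs => ?_
  refine (MvPolynomial.totalDegree_mul _ _).trans ?_
  rw [MvPolynomial.algebraMap_eq, MvPolynomial.totalDegree_C, zero_add]
  refine (MvPolynomial.totalDegree_finsetProd _ _).trans ?_
  calc ∑ i, (f i ^ s i).totalDegree ≤ ∑ i, s i * e :=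
        Finset.sum_le_sum fun i _ => (MvPolynomial.totalDegree_pow _ _).trans
          (Nat.mul_le_mul_left _ (hf i))
    _ = e * ∑ i, s i := by rw [← Finset.sum_mul, mul_comm]
    _ ≤ e * p.totalDegree := by
        refine Nat.mul_le_mul_left _ ?_
        have h := MvPolynomial.le_totalDegree hs
        rwa [Finsupp.sum_fintype _ _ (fun _ => rfl)] at h

theorem eval_aeval {m n : ℕ} (f : Fin m → MvPolynomial (Fin n) ℝ) (p : MvPolynomial (Fin m) ℝ)
    (x : Fin n → ℝ) : MvPolynomial.eval x (MvPolynomial.aeval f p) =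
      MvPolynomial.eval (fun i => MvPolynomial.eval x (f i)) p := by
  rw [MvPolynomial.aeval_def, MvPolynomial.eval₂_eq', MvPolynomial.eval_eq' _ p]
  simp [MvPolynomial.algebraMap_eq]

namespace SignClosed

variable {n B : ℕ} {X : Set (Fin n → ℝ)}

theorem mono {B' : ℕ} (h : SignClosed n B X) (hB : B ≤ B') : SignClosed n B' X := by
  obtain ⟨ι, hι, P, h1, h2⟩ := h
  exact ⟨ι, hι, P, h1.trans hB, h2⟩

theorem inter {B' : ℕ} {Y : Set (Fin n → ℝ)} (h : SignClosed n B X) (h' : SignClosed n B' Y) :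
    SignClosed n (B + B') (X ∩ Y) := by
  obtain ⟨ι, hι, P, h1, h2⟩ := h
  obtain ⟨ι', hι', P', h1', h2'⟩ := h'
  refine ⟨ι ⊕ ι', inferInstance, Sum.elim P P', ?_, ?_⟩
  · rw [Fintype.sum_sum_type]
    exact add_le_add h1 h1'
  · rintro x ⟨hx, hx'⟩ y hy
    exact ⟨h2 x hx y fun l => hy (Sum.inl l), h2' x hx' y fun l => hy (Sum.inr l)⟩

theorem preimage {m e : ℕ} (h : SignClosed n B X) (f : Fin n → MvPolynomial (Fin m) ℝ)
    (hf : ∀ i, (f i).totalDegree ≤ e) :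
    SignClosed m (e * B) {x | (fun i => MvPolynomial.eval x (f i)) ∈ X} := by
  obtain ⟨ι, hι, P, h1, h2⟩ := h
  refine ⟨ι, hι, fun l => MvPolynomial.aeval f (P l), ?_, ?_⟩
  · calc ∑ l, (MvPolynomial.aeval f (P l)).totalDegree ≤ ∑ l, e * (P l).totalDegree :=
          Finset.sum_le_sum fun l _ => totalDegree_aeval_le f hf _
      _ ≤ e * B := by
          rw [← Finset.mul_sum]
          exact Nat.mul_le_mul_left _ h1
  · intro x hx y hy
    simp only [eval_aeval] at hy
    exact h2 _ hx _ hy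

theorem halfspace (p : MvPolynomial (Fin n) ℝ) :
    SignClosed n p.totalDegree {x | 0 ≤ MvPolynomial.eval x p} :=
  ⟨Unit, inferInstance, fun _ => p, by simp, fun x hx y h => (h ()).1 hx⟩

theorem isClosed (h : SignClosed n B X) : IsClosed X := by
  obtain ⟨ι, hι, P, -, h2⟩ := h
  have hX : X = ⋃ a : {a : ι → SignType // ∃ x ∈ X, ∀ l,
      SignType.sign (MvPolynomial.eval x (P l)) = a l},
      {y | ∀ l, (0 ≤ a.1 l → 0 ≤ MvPolynomial.eval y (P l)) ∧
        (a.1 l ≤ 0 → MvPolynomial.eval y (P l) ≤ 0)} := by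
    ext y
    simp only [Set.mem_iUnion, Set.mem_ofPred_eq]
    constructor
    · intro hy
      refine ⟨⟨fun l => SignType.sign (MvPolynomial.eval y (P l)), y, hy, fun l => rfl⟩, ?_⟩
      intro l
      simp [sign_nonneg_iff, sign_nonpos_iff]
    · rintro ⟨⟨a, x, hx, hxa⟩, hy⟩
      refine h2 x hx y fun l => ?_
      have := hy l
      simp only [← hxa l, sign_nonneg_iff, sign_nonpos_iff] at this
      exact this
  rw [hX]
  have : Finite {a : ι → SignType // ∃ x ∈ X, ∀ l,
      SignType.sign (MvPolynomial.eval x (P l)) = a l} := inferInstance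
  refine isClosed_iUnion_of_finite fun a => ?_
  simp only [Set.ofPred_forall, Set.ofPred_and]
  refine isClosed_iInter fun l => ?_
  refine IsClosed.inter ?_ ?_
  · exact isClosed_iInter fun _ => isClosed_le continuous_const (MvPolynomial.continuous_eval _)
  · exact isClosed_iInter fun _ => isClosed_le (MvPolynomial.continuous_eval _) continuous_const

theorem line (h : SignClosed n B X) (x u : Fin n → ℝ) :
    ∃ R : Finset ℝ, R.card ≤ B ∧ ∀ v w : ℝ, v ≤ w →
      ¬ ((x + v • u ∈ X) ↔ (x + w • u ∈ X)) → ∃ ρ ∈ R, v ≤ ρ ∧ ρ ≤ w := by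
  classical
  obtain ⟨ι, hι, P, h1, h2⟩ := h
  set f : Fin n → Polynomial ℝ := fun i => Polynomial.C (x i) + Polynomial.C (u i) * Polynomial.X
  set q : ι → Polynomial ℝ := fun l => MvPolynomial.aeval f (P l) with hq
  have hqe : ∀ l t, (q l).eval t = MvPolynomial.eval (x + t • u) (P l) := by
    intro l t
    rw [hq]
    simp only
    rw [MvPolynomial.aeval_def, MvPolynomial.eval₂_eq', MvPolynomial.eval_eq',
      Polynomial.eval_finsetSum]
    simp [f, Polynomial.eval_prod, mul_comm t]
  have hdeg : ∀ l, (q l).natDegree ≤ (P l).totalDegree := by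
    intro l
    have := MvPolynomial.aeval_natDegree_le (P l) le_rfl f (n := 1) ?_
    · simpa using this
    · intro i
      simp only [f]
      compute_degree
  refine ⟨Finset.univ.biUnion fun l => (q l).roots.toFinset, ?_, ?_⟩
  · refine Finset.card_biUnion_le.trans (le_trans (Finset.sum_le_sum fun l _ => ?_) h1)
    exact (Multiset.toFinset_card_le _).trans ((Polynomial.card_roots' _).trans (hdeg l))
  · intro v w hvw
    contrapose!
    intro hR
    have key : ∀ l, q l = 0 ∨ ∀ t, v ≤ t → t ≤ w → (q l).eval t ≠ 0 := by
      intro l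
      by_cases h0 : q l = 0
      · exact Or.inl h0
      · refine Or.inr fun t h1 h2 h3 => ?_
        have := hR t (by simpa using ⟨l, h0, h3⟩) h1
        linarith
    have hs : ∀ l, ((0 ≤ (q l).eval v ↔ 0 ≤ (q l).eval w) ∧
        ((q l).eval v ≤ 0 ↔ (q l).eval w ≤ 0)) := by
      intro l
      rcases key l with h0 | h0
      · simp [h0]
      · have hc : ContinuousOn (fun t => (q l).eval t) (Set.uIcc v w) :=
          (q l).continuous.continuousOn
        have hiv := intermediate_value_uIcc hc
        have hn : (0 : ℝ) ∉ Set.uIcc ((q l).eval v) ((q l).eval w) := by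
          intro hm
          obtain ⟨t, ht, ht0⟩ := hiv hm
          rw [Set.uIcc_of_le hvw] at ht
          exact h0 t ht.1 ht.2 ht0
        rw [Set.mem_uIcc] at hn
        push Not at hn
        have hv0 := h0 v le_rfl hvw
        have hw0 := h0 w hvw le_rfl
        refine ⟨⟨fun h => ?_, fun h => ?_⟩, ⟨fun h => ?_, fun h => ?_⟩⟩
        · by_contra hh
          exact absurd (hn.2 (by linarith)) (by linarith)
        · by_contra hh
          exact absurd (hn.1 (by linarith)) (by linarith)
        · by_contra hh
          exact absurd (hn.1 (by linarith)) (by linarith)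
        · by_contra hh
          exact absurd (hn.2 (by linarith)) (by linarith)
    constructor
    · intro hv
      refine h2 _ hv _ fun l => ?_
      rw [← hqe, ← hqe]
      exact ⟨(hs l).1.1, (hs l).2.1⟩
    · intro hv
      refine h2 _ hv _ fun l => ?_
      rw [← hqe, ← hqe]
      exact ⟨(hs l).1.2, (hs l).2.2⟩

theorem measurableSet (h : SignClosed n B X) : MeasurableSet X := h.isClosed.measurableSet

theorem volume_exit_le (h : SignClosed n B X) (x u : Fin n → ℝ) (r : ℝ) :
    volume {v : ℝ | x + v • u ∉ X ∧ ∃ η ∈ Set.Icc 0 r, x + (v + η) • u ∈ X}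
      ≤ ENNReal.ofReal (B * r) := by
  obtain ⟨R, hR, hl⟩ := h.line x u
  have hsub : {v : ℝ | x + v • u ∉ X ∧ ∃ η ∈ Set.Icc 0 r, x + (v + η) • u ∈ X} ⊆
      ⋃ ρ ∈ R, Set.Icc (ρ - r) ρ := by
    rintro v ⟨hv, η, hη, hm⟩
    obtain ⟨ρ, hρ, h1, h2⟩ := hl v (v + η) (by linarith [hη.1]) (by tauto)
    simp only [Set.mem_iUnion]
    exact ⟨ρ, hρ, by linarith [hη.2], h1⟩
  refine (measure_mono hsub).trans ((measure_biUnion_finset_le _ _).trans ?_)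
  rcases le_or_gt 0 r with hr | hr
  · simp only [Real.volume_Icc, sub_sub_cancel, Finset.sum_const, nsmul_eq_mul]
    rw [ENNReal.ofReal_mul (by positivity), ENNReal.ofReal_natCast]
    gcongr
  · simp [ENNReal.ofReal_of_nonpos hr.le]

theorem volume_enter_le (h : SignClosed n B X) (x u : Fin n → ℝ) {r : ℝ} (hr : 0 ≤ r) :
    volume {v : ℝ | x + v • u ∈ X ∧ x + (v + r) • u ∉ X} ≤ ENNReal.ofReal (B * r) := by
  obtain ⟨R, hR, hl⟩ := h.line x u
  have hsub : {v : ℝ | x + v • u ∈ X ∧ x + (v + r) • u ∉ X} ⊆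
      ⋃ ρ ∈ R, Set.Icc (ρ - r) ρ := by
    rintro v ⟨hv, hm⟩
    obtain ⟨ρ, hρ, h1, h2⟩ := hl v (v + r) (by linarith) (by tauto)
    simp only [Set.mem_iUnion]
    exact ⟨ρ, hρ, by linarith, h1⟩
  refine (measure_mono hsub).trans ((measure_biUnion_finset_le _ _).trans ?_)
  simp only [Real.volume_Icc, sub_sub_cancel, Finset.sum_const, nsmul_eq_mul]
  rw [ENNReal.ofReal_mul (by positivity), ENNReal.ofReal_natCast]
  gcongr

end SignClosed

theorem totalDegree_pderiv_le {n : ℕ} (k : Fin n) (p : MvPolynomial (Fin n) ℝ) :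
    (MvPolynomial.pderiv k p).totalDegree ≤ p.totalDegree := by
  conv_lhs => rw [← MvPolynomial.support_sum_monomial_coeff p, map_sum]
  refine MvPolynomial.totalDegree_finsetSum_le fun s hs => ?_
  rw [MvPolynomial.pderiv_monomial]
  refine (MvPolynomial.totalDegree_monomial_le _ _).trans ?_
  refine le_trans ?_ (MvPolynomial.le_totalDegree hs)
  rw [Finsupp.sum_fintype _ _ fun _ => rfl, Finsupp.sum_fintype _ _ fun _ => rfl]
  refine Finset.sum_le_sum fun i _ => ?_
  simp

theorem hasDerivAt_eval_pderiv {n : ℕ} (k : Fin n) (p : MvPolynomial (Fin n) ℝ)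
    (y : Fin n → ℝ) :
    HasDerivAt (fun t : ℝ => MvPolynomial.eval (y + t • Pi.single k 1) p)
      (MvPolynomial.eval y (MvPolynomial.pderiv k p)) 0 := by
  induction p using MvPolynomial.induction_on with
  | C a => simpa using hasDerivAt_const (0 : ℝ) a
  | add p q hp hq => simpa using hp.fun_add hq
  | mul_X p i hp =>
    have hX : HasDerivAt (fun t : ℝ => MvPolynomial.eval (y + t • Pi.single k 1)
        (MvPolynomial.X i : MvPolynomial (Fin n) ℝ))
        (MvPolynomial.eval y (MvPolynomial.pderiv k (MvPolynomial.X i))) 0 := by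
      simp only [MvPolynomial.eval_X, Pi.add_apply, Pi.smul_apply, smul_eq_mul]
      rw [MvPolynomial.pderiv_X]
      have h1 := ((hasDerivAt_id (0 : ℝ)).mul_const
        ((Pi.single k (1 : ℝ) : Fin n → ℝ) i)).const_add (y i)
      refine h1.congr_deriv ?_
      rcases eq_or_ne i k with rfl | h
      · simp
      · simp [h]
    have := hp.fun_mul hX
    simp only [map_mul]
    refine this.congr_deriv ?_
    rw [Derivation.leibniz]
    simp
    ring

/-- Any `n + 1` polynomials in `n` variables satisfy a nontrivial relation of explicitly bounded
degree in each variable. -/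
theorem exists_algebraic_relation {n E : ℕ} (hE : 1 ≤ E)
    (f : Fin (n + 1) → MvPolynomial (Fin n) ℝ) (hf : ∑ i, (f i).totalDegree ≤ E) :
    ∃ A : MvPolynomial (Fin (n + 1)) ℝ, A ≠ 0 ∧ (∀ i, A.degreeOf i ≤ E ^ n) ∧
      MvPolynomial.aeval f A = 0 := by
  classical
  set A0 := E ^ n with hA0
  let G : (Fin (n + 1) → Fin (A0 + 1)) → MvPolynomial (Fin n) ℝ := fun a => ∏ j, f j ^ (a j : ℕ)
  let Φ : ((Fin (n + 1) → Fin (A0 + 1)) → ℝ) →ₗ[ℝ] ((Fin n → Fin (E * A0 + 1)) → ℝ) :=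
    LinearMap.pi fun e => ∑ a, (MvPolynomial.coeff
      (Finsupp.equivFunOnFinite.symm fun i => (e i : ℕ)) (G a)) • LinearMap.proj a
  have hlt : Module.finrank ℝ ((Fin n → Fin (E * A0 + 1)) → ℝ) <
      Module.finrank ℝ ((Fin (n + 1) → Fin (A0 + 1)) → ℝ) := by
    simp only [Module.finrank_fintype_fun_eq_card, Fintype.card_fun, Fintype.card_fin]
    calc (E * A0 + 1) ^ n ≤ (E * (A0 + 1)) ^ n := by gcongr; nlinarith
      _ = A0 * (A0 + 1) ^ n := by rw [mul_pow]
      _ < (A0 + 1) ^ (n + 1) := by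
          rw [pow_succ' (A0 + 1) n]
          exact Nat.mul_lt_mul_of_pos_right (Nat.lt_succ_self _) (by positivity)
  obtain ⟨c, hc, hc0⟩ := Submodule.exists_mem_ne_zero_of_ne_bot
    (LinearMap.ker_ne_bot_of_finrank_lt (f := Φ) hlt)
  let m : (Fin (n + 1) → Fin (A0 + 1)) → (Fin (n + 1) →₀ ℕ) :=
    fun a => Finsupp.equivFunOnFinite.symm fun i => (a i : ℕ)
  have hm : Function.Injective m := by
    intro a b hab
    funext i
    have := DFunLike.congr_fun hab i
    exact Fin.ext this
  let A : MvPolynomial (Fin (n + 1)) ℝ := ∑ a, MvPolynomial.monomial (m a) (c a)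
  refine ⟨A, ?_, ?_, ?_⟩
  · obtain ⟨a, ha⟩ : ∃ a, c a ≠ 0 := by
      by_contra! h
      exact hc0 (funext h)
    intro hA
    apply ha
    have : MvPolynomial.coeff (m a) A = c a := by
      simp only [A, MvPolynomial.coeff_sum, MvPolynomial.coeff_monomial]
      simp [hm.eq_iff]
    rw [← this, hA, MvPolynomial.coeff_zero]
  · intro i
    rw [MvPolynomial.degreeOf_le_iff]
    intro s hs
    have := MvPolynomial.support_sum hs
    simp only [Finset.mem_biUnion, Finset.mem_univ, true_and] at this
    obtain ⟨a, ha⟩ := this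
    have := MvPolynomial.support_monomial_subset ha
    rw [Finset.mem_singleton] at this
    rw [this]
    exact Nat.lt_succ_iff.1 (a i).2
  · have hA : MvPolynomial.aeval f A = ∑ a, MvPolynomial.C (c a) * G a := by
      simp only [A, map_sum, MvPolynomial.aeval_monomial, G, MvPolynomial.algebraMap_eq]
      refine Finset.sum_congr rfl fun a _ => ?_
      rw [Finsupp.prod_fintype _ _ fun _ => pow_zero _]
      rfl
    rw [hA]
    ext s
    rw [MvPolynomial.coeff_zero, MvPolynomial.coeff_sum]
    simp only [MvPolynomial.coeff_C_mul]
    by_cases hs : ∀ i, s i ≤ E * A0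
    · have := congrFun (LinearMap.mem_ker.1 hc) fun i => ⟨s i, Nat.lt_succ_of_le (hs i)⟩
      simp only [Φ, LinearMap.pi_apply, LinearMap.sum_apply, LinearMap.smul_apply,
        LinearMap.proj_apply, smul_eq_mul, Pi.zero_apply] at this
      rw [← this]
      refine Finset.sum_congr rfl fun a _ => ?_
      rw [mul_comm]
      congr 2
      ext i
      rfl
    · push Not at hs
      obtain ⟨i, hi⟩ := hs
      refine Finset.sum_eq_zero fun a _ => ?_
      rw [MvPolynomial.coeff_eq_zero_of_totalDegree_lt, mul_zero]
      have h1 : (G a).totalDegree ≤ E * A0 := by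
        refine (MvPolynomial.totalDegree_finsetProd _ _).trans ?_
        calc ∑ j, (f j ^ (a j : ℕ)).totalDegree ≤ ∑ j, A0 * (f j).totalDegree :=
              Finset.sum_le_sum fun j _ => (MvPolynomial.totalDegree_pow _ _).trans
                (Nat.mul_le_mul_right _ (Nat.lt_succ_iff.1 (a j).2))
          _ ≤ E * A0 := by
              rw [← Finset.mul_sum, mul_comm]
              exact Nat.mul_le_mul_right _ hf
      refine h1.trans_lt (hi.trans_le ?_)
      exact Finset.single_le_sum (f := fun i => s i) (fun _ _ => Nat.zero_le _)
        (Finsupp.mem_support_iff.2 (by omega))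

/-- The number of distinct points at which the gradient of a polynomial of degree `≤ D` takes every
sufficiently small value is bounded polynomially in `D`. -/
theorem card_le_of_gradient_eq {n D : ℕ} (hD : 1 ≤ D) {ι : Type*} [Fintype ι]
    (H : MvPolynomial (Fin n) ℝ) (hH : H.totalDegree ≤ D) (V : ι → Set (Fin n → ℝ))
    (hV : Pairwise fun i j => Disjoint (V i) (V j)) (δ : ℝ) (hδ : 0 < δ)
    (h : ∀ i, ∀ lam : Fin n → ℝ, (∀ k, lam k ∈ Set.Ioo 0 δ) → ∃ y ∈ V i, ∀ k,
      MvPolynomial.eval y (MvPolynomial.pderiv k H) = lam k) :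
    Fintype.card ι ≤ (((n + 1) * D) ^ n) ^ n := by
  classical
  have hrel : ∀ k : Fin n, ∃ A : MvPolynomial (Fin (n + 1)) ℝ, A ≠ 0 ∧
      (∀ i, A.degreeOf i ≤ ((n + 1) * D) ^ n) ∧
      MvPolynomial.aeval (Fin.cons (MvPolynomial.X k) fun l => MvPolynomial.pderiv l H :
        Fin (n + 1) → MvPolynomial (Fin n) ℝ) A = 0 := by
    intro k
    refine exists_algebraic_relation (Nat.mul_pos n.succ_pos hD) _ ?_
    rw [Fin.sum_univ_succ]
    simp only [Fin.cons_zero, Fin.cons_succ, MvPolynomial.totalDegree_X]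
    calc 1 + ∑ l, (MvPolynomial.pderiv l H).totalDegree ≤ D + ∑ _l : Fin n, D :=
          add_le_add hD (Finset.sum_le_sum fun l _ => (totalDegree_pderiv_le l H).trans hH)
      _ = (n + 1) * D := by simp; ring
  choose A hA0 hAd hAr using hrel
  let g : Fin n → MvPolynomial (Fin n) ℝ :=
    fun k => (MvPolynomial.finSuccEquiv ℝ n (A k)).leadingCoeff
  have hg : ∏ k, g k ≠ 0 := by
    rw [Finset.prod_ne_zero_iff]
    intro k _
    simpa [g] using hA0 k
  obtain ⟨lam, hlam, hlam0⟩ : ∃ lam : Fin n → ℝ, (∀ k, lam k ∈ Set.Ioo 0 δ) ∧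
      MvPolynomial.eval lam (∏ k, g k) ≠ 0 := by
    by_contra! hcon
    refine hg (MvPolynomial.funext_set (fun _ => Set.Ioo 0 δ) (fun _ => Set.Ioo_infinite hδ) ?_)
    intro x hx
    rw [map_zero]
    exact hcon x fun k => hx k trivial
  rw [map_prod, Finset.prod_ne_zero_iff] at hlam0
  let p : Fin n → Polynomial ℝ := fun k =>
    Polynomial.map (MvPolynomial.eval lam) (MvPolynomial.finSuccEquiv ℝ n (A k))
  have hp : ∀ k, p k ≠ 0 := by
    intro k hk
    refine hlam0 k (Finset.mem_univ k) ?_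
    have := congrArg (fun q => q.coeff (MvPolynomial.finSuccEquiv ℝ n (A k)).natDegree) hk
    simpa [p, Polynomial.coeff_map] using this
  have hpd : ∀ k, (p k).natDegree ≤ ((n + 1) * D) ^ n := fun k =>
    Polynomial.natDegree_map_le.trans
      ((MvPolynomial.natDegree_finSuccEquiv _).le.trans (hAd k 0))
  choose y hyV hy using fun i => h i lam hlam
  have hinj : Function.Injective y := by
    intro i j hij
    by_contra hne
    exact Set.disjoint_left.1 (hV hne) (hyV i) (hij ▸ hyV j)
  have hroot : ∀ i k, y i k ∈ (p k).roots.toFinset := by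
    intro i k
    rw [Multiset.mem_toFinset, Polynomial.mem_roots (hp k), Polynomial.IsRoot.def]
    have h1 := congrArg (MvPolynomial.eval (y i)) (hAr k)
    rw [eval_aeval, map_zero] at h1
    rw [← MvPolynomial.eval_eq_eval_mv_eval', ← h1]
    congr 2
    funext l
    refine Fin.cases ?_ (fun l => ?_) l
    · simp
    · simp [hy]
  calc Fintype.card ι = (Finset.univ : Finset ι).card := rfl
    _ ≤ (Fintype.piFinset fun k => (p k).roots.toFinset).card := by
        refine Finset.card_le_card_of_injOn y (fun i _ => ?_) hinj.injOn
        exact Fintype.mem_piFinset.2 (hroot i)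
    _ = ∏ k, ((p k).roots.toFinset).card := Fintype.card_piFinset _
    _ ≤ ∏ _k : Fin n, ((n + 1) * D) ^ n := Finset.prod_le_prod' fun k _ =>
        (Multiset.toFinset_card_le _).trans ((Polynomial.card_roots' _).trans (hpd k))
    _ = _ := by simp

/-- If the sign conditions satisfied by `x` cut out of a compact `K` only points of its open subset
`V`, then the gradient of the perturbed product takes all small values in `V`. -/
theorem eventually_exists_gradient_eq {n : ℕ} {ι : Type} [Fintype ι]
    (P : ι → MvPolynomial (Fin n) ℝ) {K V : Set (Fin n → ℝ)} (hK : IsCompact K) (hV : IsOpen V)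
    {x : Fin n → ℝ} (hxK : x ∈ K)
    (hX : ∀ y ∈ K, (∀ l, (0 ≤ MvPolynomial.eval x (P l) → 0 ≤ MvPolynomial.eval y (P l)) ∧
        (MvPolynomial.eval x (P l) ≤ 0 → MvPolynomial.eval y (P l) ≤ 0)) → y ∈ V)
    (hVK : V ⊆ K) :
    ∀ᶠ ε : ℝ in nhdsWithin 0 (Set.Ioi 0), ∃ δ > 0, ∀ lam : Fin n → ℝ,
      (∀ k, lam k ∈ Set.Ioo 0 δ) → ∃ y ∈ V, ∀ k, MvPolynomial.eval y
        (MvPolynomial.pderiv k (∏ l, (P l ^ 2 - MvPolynomial.C (ε ^ 2)))) = lam k := by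
  classical
  have h1 : ∃ ε₀ > (0 : ℝ), ∀ ε ≤ ε₀, ∀ y ∈ K \ V, ∃ l,
      (0 ≤ MvPolynomial.eval x (P l) ∧ MvPolynomial.eval y (P l) < -ε) ∨
      (MvPolynomial.eval x (P l) ≤ 0 ∧ ε < MvPolynomial.eval y (P l)) := by
    refine (hK.diff hV).induction_on (p := fun s => ∃ ε₀ > (0 : ℝ), ∀ ε ≤ ε₀, ∀ y ∈ s, ∃ l,
      (0 ≤ MvPolynomial.eval x (P l) ∧ MvPolynomial.eval y (P l) < -ε) ∨
      (MvPolynomial.eval x (P l) ≤ 0 ∧ ε < MvPolynomial.eval y (P l))) ?_ ?_ ?_ ?_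
    · exact ⟨1, one_pos, by simp⟩
    · rintro s t hst ⟨ε₀, h0, h⟩
      exact ⟨ε₀, h0, fun ε hε y hy => h ε hε y (hst hy)⟩
    · rintro s t ⟨ε₀, h0, h⟩ ⟨ε₁, h0', h'⟩
      refine ⟨min ε₀ ε₁, lt_min h0 h0', fun ε hε y hy => ?_⟩
      rcases hy with hy | hy
      · exact h ε (hε.trans (min_le_left _ _)) y hy
      · exact h' ε (hε.trans (min_le_right _ _)) y hy
    · rintro y ⟨hyK, hyV⟩
      have : ¬ ∀ l, (0 ≤ MvPolynomial.eval x (P l) → 0 ≤ MvPolynomial.eval y (P l)) ∧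
        (MvPolynomial.eval x (P l) ≤ 0 → MvPolynomial.eval y (P l) ≤ 0) :=
        fun h => hyV (hX y hyK h)
      push Not at this
      obtain ⟨l, hl⟩ := this
      have hl' : (0 ≤ MvPolynomial.eval x (P l) ∧ MvPolynomial.eval y (P l) < 0) ∨
          (MvPolynomial.eval x (P l) ≤ 0 ∧ 0 < MvPolynomial.eval y (P l)) := by
        by_cases hc : 0 ≤ MvPolynomial.eval x (P l) ∧ MvPolynomial.eval y (P l) < 0
        · exact Or.inl hc
        · push Not at hc
          exact Or.inr (hl hc)
      rcases hl' with ⟨ha, hb⟩ | ⟨ha, hb⟩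
      · refine ⟨{z | MvPolynomial.eval z (P l) < MvPolynomial.eval y (P l) / 2},
          mem_nhdsWithin_of_mem_nhds ((isOpen_lt (MvPolynomial.continuous_eval _)
            continuous_const).mem_nhds (by simp only [Set.mem_ofPred_eq]; linarith)),
          -(MvPolynomial.eval y (P l) / 2), by simp only [gt_iff_lt]; linarith, ?_⟩
        intro ε hε z hz
        simp only [Set.mem_ofPred_eq] at hz
        exact ⟨l, Or.inl ⟨ha, by linarith⟩⟩
      · refine ⟨{z | MvPolynomial.eval y (P l) / 2 < MvPolynomial.eval z (P l)},
          mem_nhdsWithin_of_mem_nhds ((isOpen_lt continuous_const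
            (MvPolynomial.continuous_eval _)).mem_nhds
              (by simp only [Set.mem_ofPred_eq]; linarith)),
          MvPolynomial.eval y (P l) / 2, by simp only [gt_iff_lt]; linarith, ?_⟩
        intro ε hε z hz
        simp only [Set.mem_ofPred_eq] at hz
        exact ⟨l, Or.inr ⟨ha, by linarith⟩⟩
  obtain ⟨ε₀, hε₀, h1⟩ := h1
  have h2 : ∀ᶠ ε : ℝ in nhdsWithin 0 (Set.Ioi 0), ∀ l, MvPolynomial.eval x (P l) ≠ 0 →
      ε < |MvPolynomial.eval x (P l)| := by
    rw [Filter.eventually_all]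
    intro l
    by_cases h0 : MvPolynomial.eval x (P l) = 0
    · simp [h0]
    · filter_upwards [Ioo_mem_nhdsGT (abs_pos.2 h0)] with ε hε _
      exact hε.2
  filter_upwards [h2, Ioo_mem_nhdsGT hε₀] with ε hε2 hε
  set H : MvPolynomial (Fin n) ℝ := ∏ l, (P l ^ 2 - MvPolynomial.C (ε ^ 2)) with hH
  have hHe : ∀ y, MvPolynomial.eval y H = ∏ l, (MvPolynomial.eval y (P l) ^ 2 - ε ^ 2) := by
    intro y
    simp [hH, map_prod]
  set U : Set (Fin n → ℝ) := {y | ∀ l,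
    (MvPolynomial.eval x (P l) = 0 → |MvPolynomial.eval y (P l)| ≤ ε) ∧
    (0 < MvPolynomial.eval x (P l) → ε ≤ MvPolynomial.eval y (P l)) ∧
    (MvPolynomial.eval x (P l) < 0 → MvPolynomial.eval y (P l) ≤ -ε)} with hU
  have hUc : IsClosed U := by
    simp only [hU, Set.ofPred_forall, Set.ofPred_and]
    refine isClosed_iInter fun l => IsClosed.inter ?_ (IsClosed.inter ?_ ?_)
    · exact isClosed_iInter fun _ => isClosed_le (MvPolynomial.continuous_eval _).abs
        continuous_const
    · exact isClosed_iInter fun _ => isClosed_le continuous_const (MvPolynomial.continuous_eval _)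
    · exact isClosed_iInter fun _ => isClosed_le (MvPolynomial.continuous_eval _) continuous_const
  have hUV : ∀ y ∈ K, y ∈ U → y ∈ V := by
    intro y hy hyU
    by_contra hyV
    obtain ⟨l, hl⟩ := h1 ε hε.2.le y ⟨hy, hyV⟩
    obtain ⟨ha, hb, hc⟩ := hyU l
    rcases lt_trichotomy (MvPolynomial.eval x (P l)) 0 with h | h | h
    · have := hc h
      rcases hl with hl | hl
      · linarith [hl.1]
      · linarith [hl.2, hε.1]
    · have := abs_le.1 (ha h)
      rcases hl with hl | hl
      · linarith [hl.2]
      · linarith [hl.2]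
    · have := hb h
      rcases hl with hl | hl
      · linarith [hl.2, hε.1]
      · linarith [hl.1]
  have hxU : x ∈ U := by
    intro l
    refine ⟨fun h => ?_, fun h => ?_, fun h => ?_⟩
    · simp [h, hε.1.le]
    · have := hε2 l h.ne'
      rw [abs_of_pos h] at this
      exact this.le
    · have := hε2 l h.ne
      rw [abs_of_neg h] at this
      linarith
  set τ := MvPolynomial.eval x H with hτ
  have hτ0 : τ ≠ 0 := by
    rw [hτ, hHe, Finset.prod_ne_zero_iff]
    intro l _
    by_cases h : MvPolynomial.eval x (P l) = 0
    · have := hε.1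
      simp [h, this.ne']
    · have := sq_lt_sq' (by linarith [hε.1, abs_nonneg (MvPolynomial.eval x (P l))]) (hε2 l h)
      rw [sq_abs] at this
      linarith
  have hnhds : ∀ y ∈ K, y ∈ U → MvPolynomial.eval y H ≠ 0 → U ∩ K ∈ nhds y := by
    intro y hyK hyU hy0
    have hyV := hUV y hyK hyU
    refine Filter.inter_mem ?_ (Filter.mem_of_superset (hV.mem_nhds hyV) hVK)
    rw [hHe, Finset.prod_ne_zero_iff] at hy0
    have key : ∀ l, ∀ᶠ z in nhds y,
      (MvPolynomial.eval x (P l) = 0 → |MvPolynomial.eval z (P l)| ≤ ε) ∧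
      (0 < MvPolynomial.eval x (P l) → ε ≤ MvPolynomial.eval z (P l)) ∧
      (MvPolynomial.eval x (P l) < 0 → MvPolynomial.eval z (P l) ≤ -ε) := by
      intro l
      have hne : MvPolynomial.eval y (P l) ^ 2 ≠ ε ^ 2 := fun h =>
        hy0 l (Finset.mem_univ l) (by rw [h, sub_self])
      have hct : Filter.Tendsto (fun z => MvPolynomial.eval z (P l)) (nhds y)
        (nhds (MvPolynomial.eval y (P l))) := (MvPolynomial.continuous_eval (P l)).tendsto y
      obtain ⟨ha, hb, hc⟩ := hyU l
      rcases lt_trichotomy (MvPolynomial.eval x (P l)) 0 with h | h | h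
      · have h3 : MvPolynomial.eval y (P l) < -ε := lt_of_le_of_ne (hc h) fun h => hne (by
          rw [h]; ring)
        filter_upwards [hct.eventually_lt_const h3] with z hz
        exact ⟨fun h' => absurd h' h.ne, fun h' => absurd h' h.not_gt, fun _ => hz.le⟩
      · have h3 : |MvPolynomial.eval y (P l)| < ε := lt_of_le_of_ne (ha h) fun h => hne (by
          rw [← h, sq_abs])
        filter_upwards [hct.abs.eventually_lt_const h3] with z hz
        exact ⟨fun _ => hz.le, fun h' => absurd h' (by simp [h]), fun h' => absurd h' (by simp [h])⟩
      · have h3 : ε < MvPolynomial.eval y (P l) := lt_of_le_of_ne (hb h) fun h => hne (by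
          rw [h])
        filter_upwards [hct.eventually_const_lt h3] with z hz
        exact ⟨fun h' => absurd h' h.ne', fun _ => hz.le, fun h' => absurd h' h.not_gt⟩
    exact Filter.eventually_all.2 key
  obtain ⟨R, hR0, hR⟩ : ∃ R > 0, ∀ y ∈ K, ∀ k, |y k - x k| ≤ R := by
    obtain ⟨R, hR⟩ := hK.isBounded.subset_closedBall x
    refine ⟨max R 1, by positivity, fun y hy k => ?_⟩
    have := hR hy
    rw [Metric.mem_closedBall, dist_eq_norm] at this
    exact (norm_le_pi_norm (y - x) k).trans (this.trans (le_max_left _ _))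
  refine ⟨|τ| / ((n + 1) * R), by positivity, fun lam hlam => ?_⟩
  have hsmall : ∀ y ∈ K, |∑ k, lam k * (y k - x k)| < |τ| := by
    intro y hy
    calc |∑ k, lam k * (y k - x k)| ≤ ∑ k, |lam k * (y k - x k)| := Finset.abs_sum_le_sum_abs _ _
      _ ≤ ∑ _k : Fin n, |τ| / ((n + 1) * R) * R := by
          refine Finset.sum_le_sum fun k _ => ?_
          rw [abs_mul, abs_of_pos (hlam k).1]
          exact mul_le_mul (hlam k).2.le (hR y hy k) (abs_nonneg _) (by positivity)
      _ = |τ| * (n / (n + 1)) := by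
          simp only [Finset.sum_const, Finset.card_univ, Fintype.card_fin, nsmul_eq_mul]
          field_simp
      _ < |τ| * 1 := by
          refine mul_lt_mul_of_pos_left ?_ (abs_pos.2 hτ0)
          rw [div_lt_one (by positivity)]
          linarith
      _ = |τ| := mul_one _
  let φ : (Fin n → ℝ) → ℝ := fun y =>
    τ * (MvPolynomial.eval y H - ∑ k, lam k * (y k - x k))
  have hφc : Continuous φ := by
    have := MvPolynomial.continuous_eval H
    fun_prop
  obtain ⟨y, ⟨hyU, hyK⟩, hymax⟩ := (hK.inter_left hUc).exists_isMaxOn ⟨x, hxU, hxK⟩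
    hφc.continuousOn
  have hy0 : MvPolynomial.eval y H ≠ 0 := by
    intro h0
    have h3 : φ x ≤ φ y := hymax ⟨hxU, hxK⟩
    simp only [φ, h0, sub_self, mul_zero, Finset.sum_const_zero, sub_zero, zero_sub, ← hτ] at h3
    have h4 : |τ| * |τ| ≤ |τ| * |∑ k, lam k * (y k - x k)| := by
      rw [← abs_mul, ← abs_mul, abs_mul_self]
      refine h3.trans ((le_abs_self _).trans ?_)
      rw [mul_neg, abs_neg]
    have h5 := le_of_mul_le_mul_left h4 (abs_pos.2 hτ0)
    exact absurd (hsmall y hyK) (not_lt.2 h5)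
  refine ⟨y, hUV y hyK hyU, fun k => ?_⟩
  have hloc : IsLocalMax φ y := hymax.isLocalMax (hnhds y hyK hyU hy0)
  have hcurve : Filter.Tendsto (fun t : ℝ => y + t • (Pi.single k (1 : ℝ) : Fin n → ℝ)) (nhds 0)
      (nhds y) := by
    have : Continuous fun t : ℝ => y + t • (Pi.single k (1 : ℝ) : Fin n → ℝ) := by fun_prop
    simpa using this.tendsto 0
  have hloc' : IsLocalMax (fun t : ℝ => φ (y + t • (Pi.single k (1 : ℝ) : Fin n → ℝ))) 0 := by
    have := hcurve.eventually hloc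
    simpa [IsLocalMax, IsMaxFilter] using this
  have hlin : HasDerivAt (fun t : ℝ => ∑ i, lam i *
      ((y + t • (Pi.single k (1 : ℝ) : Fin n → ℝ)) i - x i)) (lam k) 0 := by
    have h3 : HasDerivAt (fun t : ℝ => ∑ i, lam i *
      ((y + t • (Pi.single k (1 : ℝ) : Fin n → ℝ)) i - x i))
        (∑ i, lam i * (1 * (Pi.single k (1 : ℝ) : Fin n → ℝ) i)) 0 := by
      refine HasDerivAt.fun_sum fun i _ => ?_
      exact ((((hasDerivAt_id (0 : ℝ)).mul_const _).const_add (y i)).sub_const (x i)).const_mul _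
    refine h3.congr_deriv ?_
    simp [Pi.single_apply]
  have hder := (((hasDerivAt_eval_pderiv k H y).sub hlin).const_mul τ)
  have h4 := hloc'.hasDerivAt_eq_zero hder
  have h5 := (mul_eq_zero.1 h4).resolve_left hτ0
  linarith

/-- A sign-closed set has few parts isolated by disjoint open sets with compact envelopes. -/
theorem SignClosed.card_isolated_le {n B : ℕ} (hB : 1 ≤ B) {X : Set (Fin n → ℝ)}
    (hX : SignClosed n B X) {ι : Type*} [Fintype ι] (K V : ι → Set (Fin n → ℝ))
    (hK : ∀ i, IsCompact (K i)) (hV : ∀ i, IsOpen (V i)) (hVK : ∀ i, V i ⊆ K i)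
    (hd : Pairwise fun i j => Disjoint (V i) (V j)) (hne : ∀ i, (X ∩ V i).Nonempty)
    (hXK : ∀ i, X ∩ K i ⊆ V i) :
    Fintype.card ι ≤ (((n + 1) * (2 * B)) ^ n) ^ n := by
  classical
  obtain ⟨ι', hι', P, h1, h2⟩ := hX
  choose x hx using hne
  have hev : ∀ᶠ ε : ℝ in nhdsWithin 0 (Set.Ioi 0), ∀ i, ∃ δ > 0, ∀ lam : Fin n → ℝ,
      (∀ k, lam k ∈ Set.Ioo 0 δ) → ∃ y ∈ V i, ∀ k, MvPolynomial.eval y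
        (MvPolynomial.pderiv k (∏ l, (P l ^ 2 - MvPolynomial.C (ε ^ 2)))) = lam k := by
    have : ∀ i : ι, _ := fun i => eventually_exists_gradient_eq P (hK i) (hV i)
      (hVK i (hx i).2) (fun y hy h => hXK i ⟨h2 _ (hx i).1 y h, hy⟩) (hVK i)
    exact Filter.eventually_all.2 this
  obtain ⟨ε, hε⟩ := hev.exists
  choose δ hδ0 hδ using hε
  obtain ⟨δ₀, hδ₀, hδ₀'⟩ : ∃ δ₀ > 0, ∀ i, δ₀ ≤ δ i := by
    rcases isEmpty_or_nonempty ι with h | h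
    · exact ⟨1, one_pos, fun i => h.elim i⟩
    · obtain ⟨i, hi⟩ := Finite.exists_min δ
      exact ⟨δ i, hδ0 i, hi⟩
  refine card_le_of_gradient_eq (by omega) (∏ l, (P l ^ 2 - MvPolynomial.C (ε ^ 2))) ?_ V hd δ₀ hδ₀
    fun i lam hlam => hδ i lam fun k => ⟨(hlam k).1, (hlam k).2.trans_le (hδ₀' i)⟩
  refine (MvPolynomial.totalDegree_finsetProd _ _).trans ?_
  calc ∑ l, (P l ^ 2 - MvPolynomial.C (ε ^ 2)).totalDegree ≤ ∑ l, 2 * (P l).totalDegree := by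
        refine Finset.sum_le_sum fun l _ => ?_
        refine (MvPolynomial.totalDegree_sub _ _).trans ?_
        rw [MvPolynomial.totalDegree_C, max_eq_left (Nat.zero_le _)]
        exact MvPolynomial.totalDegree_pow _ _
    _ ≤ 2 * B := by
        rw [← Finset.mul_sum]
        exact Nat.mul_le_mul_left _ h1

theorem volume_preimage_succAbove {n : ℕ} (k : Fin (n + 1)) (I : Set ℝ)
    (U : Set (Fin n → ℝ)) :
    volume {a : Fin (n + 1) → ℝ | a k ∈ I ∧ (fun j => a (k.succAbove j)) ∈ U} =
      volume I * volume U := by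
  have h := (volume_preserving_piFinSuccAbove (fun _ : Fin (n + 1) => ℝ) k).measure_preimage_equiv
    (I ×ˢ U)
  rw [Measure.volume_eq_prod, Measure.prod_prod] at h
  rw [← h]
  congr 1

theorem SignClosed.slice {n B : ℕ} {X : Set (Fin (n + 1) → ℝ)} (hX : SignClosed (n + 1) B X)
    (i : Fin (n + 1)) (t : ℝ) :
    SignClosed n B {y : Fin n → ℝ | (i.insertNth t y : Fin (n + 1) → ℝ) ∈ X} := by
  have h := hX.preimage (m := n) (e := 1)
    (i.insertNth (MvPolynomial.C t) fun j => MvPolynomial.X j) ?_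
  · rw [one_mul] at h
    convert h using 4 with y
    funext l
    refine Fin.succAboveCases i ?_ (fun j => ?_) l
    · simp
    · simp
  · intro l
    refine Fin.succAboveCases i ?_ (fun j => ?_) l
    · simp
    · simp

/-- The cells of a translated unit grid met by a sign-closed set are, up to boundedly many, those
whose boundary is met. -/
theorem SignClosed.exists_cells {n B : ℕ} (hB : 1 ≤ B) {X : Set (Fin n → ℝ)}
    (hX : SignClosed n B X) (L : ℕ) (hL : ∀ x ∈ X, ∀ i, x i ∈ Set.Icc (0 : ℝ) L)
    (a : Fin n → ℝ) :
    ∃ F : Finset (Fin n → ℤ), F.card ≤ (((n + 1) * (2 * B)) ^ n) ^ n ∧ ∀ z : Fin n → ℤ,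
      (∃ x ∈ X, ∀ i, ⌊x i - a i⌋ = z i) → z ∈ F ∨ ∃ y ∈ X,
        (∀ j, (z j : ℝ) ≤ y j - a j ∧ y j - a j ≤ z j + 1) ∧ ∃ i, ∃ t : ℤ, y i - a i = t := by
  classical
  let K : (Fin n → ℤ) → Set (Fin n → ℝ) := fun z =>
    Set.Icc (fun j => a j + z j) (fun j => a j + z j + 1)
  let V : (Fin n → ℤ) → Set (Fin n → ℝ) := fun z =>
    Set.univ.pi fun j => Set.Ioo (a j + z j) (a j + z j + 1)
  let F := (Fintype.piFinset fun i => Finset.Icc ⌊-a i⌋ ⌊(L : ℝ) - a i⌋).filter fun z =>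
    (∃ x ∈ X, ∀ i, ⌊x i - a i⌋ = z i) ∧ X ∩ K z ⊆ V z
  have hcell : ∀ (z : Fin n → ℤ) (x : Fin n → ℝ), (∀ i, ⌊x i - a i⌋ = z i) → x ∈ K z := by
    intro z x h
    refine ⟨fun i => ?_, fun i => ?_⟩
    · have := Int.floor_le (x i - a i)
      rw [h] at this
      simp only
      linarith
    · have := Int.lt_floor_add_one (x i - a i)
      rw [h] at this
      simp only
      linarith
  refine ⟨F, ?_, ?_⟩
  · have := hX.card_isolated_le hB (ι := F) (fun z => K z.1) (fun z => V z.1)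
      (fun z => isCompact_Icc) (fun z => isOpen_set_pi Set.finite_univ fun _ _ => isOpen_Ioo)
      (fun z y hy => ⟨fun j => (hy j trivial).1.le, fun j => (hy j trivial).2.le⟩) ?_ ?_ ?_
    · simpa using this
    · intro z z' hzz
      refine Set.disjoint_left.2 ?_
      intro y hy hy'
      apply hzz
      apply Subtype.ext
      funext j
      have h1 := hy j trivial
      have h2 := hy' j trivial
      have h3 : (z.1 j : ℝ) < z'.1 j + 1 := by linarith [h1.1, h2.2]
      have h4 : (z'.1 j : ℝ) < z.1 j + 1 := by linarith [h2.1, h1.2]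
      norm_cast at h3 h4
      omega
    · rintro ⟨z, hz⟩
      obtain ⟨-, ⟨x, hx, hxz⟩, h⟩ := Finset.mem_filter.1 hz
      exact ⟨x, hx, h ⟨hx, hcell z x hxz⟩⟩
    · rintro ⟨z, hz⟩
      exact (Finset.mem_filter.1 hz).2.2
  · rintro z ⟨x, hx, hxz⟩
    by_cases hz : X ∩ K z ⊆ V z
    · left
      refine Finset.mem_filter.2 ⟨?_, ⟨x, hx, hxz⟩, hz⟩
      rw [Fintype.mem_piFinset]
      intro i
      rw [Finset.mem_Icc, ← hxz i]
      have := hL x hx i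
      exact ⟨Int.floor_le_floor (by linarith [this.1]), Int.floor_le_floor (by linarith [this.2])⟩
    · right
      obtain ⟨y, ⟨hyX, hyK⟩, hyV⟩ := Set.not_subset.1 hz
      refine ⟨y, hyX, fun j => ?_, ?_⟩
      · have h1 := hyK.1 j
        have h2 := hyK.2 j
        simp only at h1 h2
        exact ⟨by linarith, by linarith⟩
      · simp only [V, Set.mem_pi, Set.mem_univ, forall_true_left, not_forall] at hyV
        obtain ⟨i, hi⟩ := hyV
        have h1 := hyK.1 i
        have h2 := hyK.2 i
        simp only at h1 h2
        refine ⟨i, ?_⟩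
        rcases eq_or_lt_of_le h1 with h | h
        · exact ⟨z i, by linarith⟩
        · rcases eq_or_lt_of_le h2 with h' | h'
          · exact ⟨z i + 1, by push_cast; linarith⟩
          · exact absurd ⟨h, h'⟩ hi

/-- A sign-closed set missing all lines of a translated unit grid meets few of its cells. -/
theorem exists_cells_of_no_grid_line (m : ℕ) : ∃ C : ℕ, ∀ B L : ℕ, 1 ≤ B → 1 ≤ L →
    ∀ X : Set (Fin (m + 2) → ℝ), SignClosed (m + 2) B X →
    (∀ x ∈ X, ∀ i, x i ∈ Set.Icc (0 : ℝ) L) → ∀ a : Fin (m + 2) → ℝ,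
    (∀ x ∈ X, ¬ ∃ k, ∀ i, i ≠ k → ∃ z : ℤ, x i - a i = z) →
    ∃ F : Finset (Fin (m + 2) → ℤ), F.card ≤ C * L ^ m * B ^ C ∧
      ∀ x ∈ X, (fun i => ⌊x i - a i⌋) ∈ F := by
  classical
  induction m with
  | zero =>
    refine ⟨(6 ^ 2) ^ 2 + 4, fun B L hB hL X hX hXL a ha => ?_⟩
    obtain ⟨F, hF, h⟩ := hX.exists_cells hB L hXL a
    refine ⟨F, hF.trans ?_, fun x hx => ?_⟩
    · calc (((0 + 2 + 1) * (2 * B)) ^ (0 + 2)) ^ (0 + 2) = ((6 ^ 2) ^ 2) * 1 * B ^ 4 := by ring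
        _ ≤ _ := by
          refine Nat.mul_le_mul (Nat.mul_le_mul (by omega) (by simp)) ?_
          exact Nat.pow_le_pow_right hB (by omega)
    · rcases h _ ⟨x, hx, fun i => rfl⟩ with h | ⟨y, hy, -, i, t, hit⟩
      · exact h
      · exfalso
        refine ha y hy ⟨1 - i, fun j hj => ?_⟩
        have : j = i := by
          fin_cases i <;> fin_cases j <;> simp_all
        exact ⟨t, this ▸ hit⟩
  | succ m ih =>
    obtain ⟨C, hC⟩ := ih
    refine ⟨((m + 4) * 2) ^ ((m + 3) * (m + 3)) + (m + 3) * 2 * C * 2 ^ (m + 3) +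
      (m + 3) * (m + 3) + C, fun B L hB hL X hX hXL a ha => ?_⟩
    obtain ⟨F, hF, h⟩ := hX.exists_cells hB L hXL a
    have hsl : ∀ (i : Fin (m + 3)) (t : ℤ), ∃ G : Finset (Fin (m + 2) → ℤ),
        G.card ≤ C * L ^ m * B ^ C ∧ ∀ y : Fin (m + 2) → ℝ,
          (i.insertNth (a i + t) y : Fin (m + 3) → ℝ) ∈ X →
            (fun j => ⌊y j - a (i.succAbove j)⌋) ∈ G := by
      intro i t
      refine hC B L hB hL _ (hX.slice i (a i + t)) (fun y hy j => ?_) (fun j => a (i.succAbove j))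
        fun y hy => ?_
      · simpa using hXL _ hy (i.succAbove j)
      · rintro ⟨k, hk⟩
        refine ha _ hy ⟨i.succAbove k, fun l => ?_⟩
        refine Fin.succAboveCases i (fun _ => ⟨t, by simp⟩) (fun j hj => ?_) l
        simpa using hk j fun h => hj (by rw [h])
    choose G hGc hG using hsl
    let T : Fin (m + 3) → Finset ℤ := fun i => Finset.Icc ⌈-a i⌉ ⌊(L : ℝ) - a i⌋
    have hT : ∀ i, (T i).card ≤ L + 1 := by
      intro i
      simp only [T, Int.card_Icc]
      have h1 := Int.le_ceil (-a i)
      have h2 := Int.floor_le ((L : ℝ) - a i)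
      have h3 : (⌊(L : ℝ) - a i⌋ : ℝ) ≤ (L : ℤ) + ⌈-a i⌉ := by push_cast; linarith
      norm_cast at h3
      omega
    let F2 : Finset (Fin (m + 3) → ℤ) := Finset.univ.biUnion fun i => (T i).biUnion fun t =>
      (G i t ×ˢ (Finset.univ : Finset (Fin (m + 3) → Fin 2))).image fun p =>
        fun l => (i.insertNth t p.1 : Fin (m + 3) → ℤ) l - (p.2 l : ℕ)
    have hF2 : F2.card ≤ (m + 3) * ((L + 1) * (C * L ^ m * B ^ C * 2 ^ (m + 3))) := by
      refine (Finset.card_biUnion_le_card_mul _ _ _ fun i _ => ?_).trans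
        (Nat.mul_le_mul_right ((L + 1) * (C * L ^ m * B ^ C * 2 ^ (m + 3))) (by simp))
      refine (Finset.card_biUnion_le_card_mul _ _ _ fun t _ => ?_).trans
        (Nat.mul_le_mul_right _ (hT i))
      refine Finset.card_image_le.trans ?_
      rw [Finset.card_product]
      refine Nat.mul_le_mul (hGc i t) ?_
      simp
    refine ⟨F ∪ F2, (Finset.card_union_le _ _).trans ?_, fun x hx => ?_⟩
    · set K1 := ((m + 4) * 2) ^ ((m + 3) * (m + 3)) with hK1
      set n2 := (m + 3) * (m + 3) with hn2
      set C' := K1 + (m + 3) * 2 * C * 2 ^ (m + 3) + n2 + C with hC'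
      have e1 : F.card ≤ K1 * L ^ (m + 1) * B ^ C' := by
        refine hF.trans ?_
        calc (((m + 1 + 2 + 1) * (2 * B)) ^ (m + 1 + 2)) ^ (m + 1 + 2)
            = K1 * 1 * B ^ n2 := by
              rw [← pow_mul, ← mul_assoc, mul_pow, mul_one]
          _ ≤ _ := Nat.mul_le_mul (Nat.mul_le_mul le_rfl (Nat.one_le_pow _ _ hL))
            (Nat.pow_le_pow_right hB (by omega))
      have e2 : F2.card ≤ (m + 3) * 2 * C * 2 ^ (m + 3) * L ^ (m + 1) * B ^ C' := by
        refine hF2.trans ?_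
        calc (m + 3) * ((L + 1) * (C * L ^ m * B ^ C * 2 ^ (m + 3)))
            ≤ (m + 3) * ((2 * L) * (C * L ^ m * B ^ C' * 2 ^ (m + 3))) := by
              gcongr
              · omega
              · omega
          _ = _ := by ring
      calc F.card + F2.card ≤ (K1 + (m + 3) * 2 * C * 2 ^ (m + 3)) * L ^ (m + 1) * B ^ C' := by
            rw [add_mul, add_mul]
            exact add_le_add e1 e2
        _ ≤ _ := by
            refine Nat.mul_le_mul_right _ (Nat.mul_le_mul_right _ ?_)
            omega
    · rcases h _ ⟨x, hx, fun i => rfl⟩ with h | ⟨y, hy, hyz, i, t, hit⟩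
      · exact Finset.mem_union_left _ h
      · refine Finset.mem_union_right _ ?_
        simp only [F2, Finset.mem_biUnion, Finset.mem_univ, true_and, Finset.mem_image,
          Finset.mem_product, and_true, Prod.exists]
        have hyi : y i = a i + t := by linarith
        refine ⟨i, t, ?_, fun j => ⌊y (i.succAbove j) - a (i.succAbove j)⌋, ?_⟩
        · have := hXL y hy i
          rw [Finset.mem_Icc]
          exact ⟨Int.ceil_le.2 (by linarith [this.1]), Int.le_floor.2 (by linarith [this.2])⟩
        · have hfl : ∀ l, (i.insertNth t (fun j => ⌊y (i.succAbove j) - a (i.succAbove j)⌋) :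
              Fin (m + 3) → ℤ) l = ⌊y l - a l⌋ := by
            intro l
            refine Fin.succAboveCases i ?_ (fun j => ?_) l
            · simp [hit]
            · simp
          have he : ∀ l, ∃ e : Fin 2, ⌊y l - a l⌋ - ((e : ℕ) : ℤ) = ⌊x l - a l⌋ := by
            intro l
            have h1 := (hyz l).1
            have h2 := (hyz l).2
            have h3 := Int.le_floor.2 h1
            have h4 : ⌊y l - a l⌋ ≤ ⌊x l - a l⌋ + 1 := by
              have := (Int.floor_le (y l - a l)).trans h2
              exact_mod_cast this
            rcases eq_or_ne ⌊y l - a l⌋ ⌊x l - a l⌋ with h5 | h5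
            · exact ⟨0, by simpa using h5⟩
            · refine ⟨1, ?_⟩
              simp only [Fin.val_one, Nat.cast_one]
              omega
          choose e he using he
          refine ⟨e, hG i t _ ?_, ?_⟩
          · convert hy using 1
            funext l
            refine Fin.succAboveCases i ?_ (fun j => ?_) l
            · simp [hyi]
            · simp
          · funext l
            rw [hfl, he]

/-- Separated points in a sign-closed set with small coordinate-hyperplane projections. -/
theorem card_le_of_volume_projections (m : ℕ) : ∃ C : ℕ, ∀ B L : ℕ, 1 ≤ B → 1 ≤ L →
    ∀ X : Set (Fin (m + 2) → ℝ), SignClosed (m + 2) B X →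
    (∀ x ∈ X, ∀ i, x i ∈ Set.Icc (0 : ℝ) L) →
    (∀ k : Fin (m + 2), ((m + 2) * (L + 2) ^ (m + 1) : ℕ) *
      volume ((fun x : Fin (m + 2) → ℝ => fun j => x (k.succAbove j)) '' X) < 1) →
    ∀ T : Finset (Fin (m + 2) → ℝ), (∀ x ∈ T, x ∈ X) →
    (∀ x ∈ T, ∀ y ∈ T, x ≠ y → ∃ i, 1 ≤ |x i - y i|) → T.card ≤ C * L ^ m * B ^ C := by
  classical
  obtain ⟨C, hC⟩ := exists_cells_of_no_grid_line m
  refine ⟨C, fun B L hB hL X hX hXL hvol T hTX hT => ?_⟩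
  by_contra hcard
  push Not at hcard
  have hline : ∀ a : Fin (m + 2) → ℝ, ∃ x ∈ X, ∃ k, ∀ i, i ≠ k → ∃ z : ℤ, x i - a i = z := by
    intro a
    by_contra! hcon
    obtain ⟨F, hF, h⟩ := hC B L hB hL X hX hXL a (fun x hx ⟨k, hk⟩ => by
      obtain ⟨i, hi, hz⟩ := hcon x hx k
      obtain ⟨z, hz'⟩ := hk i hi
      exact hz z hz')
    refine absurd (hF.trans_lt hcard) (not_lt.2 ?_)
    refine Finset.card_le_card_of_injOn (fun x i => ⌊x i - a i⌋) (fun x hx => h x (hTX x hx)) ?_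
    intro x hx y hy hxy
    by_contra hne
    obtain ⟨i, hi⟩ := hT x hx y hy hne
    have := Int.abs_sub_lt_one_of_floor_eq_floor (congrFun hxy i)
    rw [sub_sub_sub_cancel_right] at this
    linarith
  let pr : Fin (m + 2) → (Fin (m + 2) → ℝ) → Fin (m + 1) → ℝ :=
    fun k x j => x (k.succAbove j)
  let Z : Finset (Fin (m + 1) → ℤ) := Fintype.piFinset fun _ => Finset.Icc (-1) (L : ℤ)
  have hZ : Z.card = (L + 2) ^ (m + 1) := by
    simp only [Z, Fintype.card_piFinset, Int.card_Icc, Finset.prod_const, Finset.card_univ,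
      Fintype.card_fin]
    rw [show ((L : ℤ) + 1 - -1).toNat = L + 2 by omega]
  let U : Fin (m + 2) → Set (Fin (m + 1) → ℝ) := fun k =>
    ⋃ z ∈ Z, (fun b => b + fun j => (z j : ℝ)) ⁻¹' (pr k '' X)
  have hU : ∀ k, volume (U k) ≤ ((L + 2) ^ (m + 1) : ℕ) * volume (pr k '' X) := by
    intro k
    refine (measure_biUnion_finset_le _ _).trans ?_
    simp only [measure_preimage_add_right, Finset.sum_const, hZ, nsmul_eq_mul, le_refl]
  have hcov : (Set.univ.pi fun _ : Fin (m + 2) => Set.Icc (0 : ℝ) 1) ⊆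
      ⋃ k, {a | a k ∈ Set.Icc (0 : ℝ) 1 ∧ (fun j => a (k.succAbove j)) ∈ U k} := by
    intro a ha
    obtain ⟨x, hx, k, hk⟩ := hline a
    simp only [Set.mem_iUnion]
    refine ⟨k, ha k trivial, ?_⟩
    choose z hz using fun j : Fin (m + 1) => hk (k.succAbove j) (Fin.succAbove_ne k j)
    simp only [U, Set.mem_iUnion]
    refine ⟨z, ?_, x, hx, ?_⟩
    · rw [Fintype.mem_piFinset]
      intro j
      have h1 := hXL x hx (k.succAbove j)
      have h2 := ha (k.succAbove j) trivial
      rw [Finset.mem_Icc]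
      constructor
      · have : ((-1 : ℤ) : ℝ) ≤ z j := by rw [← hz]; push_cast; linarith [h1.1, h2.2]
        exact_mod_cast this
      · have : (z j : ℝ) ≤ (L : ℤ) := by rw [← hz]; push_cast; linarith [h1.2, h2.1]
        exact_mod_cast this
    · funext j
      simp only [pr, Pi.add_apply, ← hz]
      ring
  have h1 : (1 : ENNReal) ≤ ∑ k, volume (U k) := by
    calc (1 : ENNReal) = volume (Set.univ.pi fun _ : Fin (m + 2) => Set.Icc (0 : ℝ) 1) := by
          rw [volume_pi_pi]
          simp
      _ ≤ ∑ k, volume {a : Fin (m + 2) → ℝ | a k ∈ Set.Icc (0 : ℝ) 1 ∧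
          (fun j => a (k.succAbove j)) ∈ U k} :=
          (measure_mono hcov).trans (measure_iUnion_fintype_le _ _)
      _ = ∑ k, volume (U k) := by
          refine Finset.sum_congr rfl fun k _ => ?_
          rw [volume_preimage_succAbove]
          simp
  have h2 : ((m + 2 : ℕ) : ENNReal) ≤ ∑ k : Fin (m + 2), (m + 2 : ℕ) * volume (U k) := by
    rw [← Finset.mul_sum]
    exact le_mul_of_one_le_right' h1
  have h3 : ∑ k : Fin (m + 2), ((m + 2 : ℕ) : ENNReal) * volume (U k) <
      ∑ _k : Fin (m + 2), (1 : ENNReal) := by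
    refine ENNReal.sum_lt_sum_of_nonempty Finset.univ_nonempty fun k _ => ?_
    refine lt_of_le_of_lt ?_ (hvol k)
    push_cast
    rw [mul_assoc]
    have := hU k
    push_cast at this
    gcongr
  simp only [Finset.sum_const, Finset.card_univ, Fintype.card_fin, nsmul_eq_mul, mul_one] at h3
  exact absurd h3 (not_lt.2 h2)

/-- Families of `d` reals with equal power sums of orders `1, …, d` agree as multisets. -/
theorem multiset_map_eq_of_sum_pow_eq {d : ℕ} (x y : Fin d → ℝ)
    (h : ∀ e, 1 ≤ e → e ≤ d → ∑ i, x i ^ e = ∑ i, y i ^ e) :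
    Multiset.map x Finset.univ.val = Multiset.map y Finset.univ.val := by
  have hes : ∀ k ≤ d, MvPolynomial.aeval x (MvPolynomial.esymm (Fin d) ℝ k) =
      MvPolynomial.aeval y (MvPolynomial.esymm (Fin d) ℝ k) := by
    intro k
    induction k using Nat.strong_induction_on with
    | _ k ih =>
      intro hk
      rcases Nat.eq_zero_or_pos k with rfl | hk0
      · simp
      have key := MvPolynomial.mul_esymm_eq_sum (Fin d) ℝ k
      have hx := congrArg (MvPolynomial.aeval x) key
      have hy := congrArg (MvPolynomial.aeval y) key
      simp only [map_mul, map_natCast, map_pow, map_neg, map_one, map_sum,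
        MvPolynomial.psum, MvPolynomial.aeval_X] at hx hy
      have : (k : ℝ) * MvPolynomial.aeval x (MvPolynomial.esymm (Fin d) ℝ k) =
          k * MvPolynomial.aeval y (MvPolynomial.esymm (Fin d) ℝ k) := by
        rw [hx, hy]
        congr 1
        refine Finset.sum_congr rfl fun a ha => ?_
        rw [Finset.mem_filter, Finset.HasAntidiagonal.mem_antidiagonal] at ha
        rw [ih a.1 ha.2 (by omega), h a.2 (by omega) (by omega)]
      exact mul_left_cancel₀ (by positivity) this
  have hprod : (Multiset.map (fun t => Polynomial.X - Polynomial.C t)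
      (Multiset.map x Finset.univ.val)).prod = (Multiset.map (fun t => Polynomial.X -
        Polynomial.C t) (Multiset.map y Finset.univ.val)).prod := by
    rw [Multiset.prod_X_sub_X_eq_sum_esymm, Multiset.prod_X_sub_X_eq_sum_esymm]
    simp only [Multiset.card_map]
    refine Finset.sum_congr rfl fun j hj => ?_
    have hjd : j ≤ d := by simpa [Nat.lt_succ_iff] using hj
    rw [← MvPolynomial.aeval_esymm_eq_multiset_esymm (Fin d) ℝ,
      ← MvPolynomial.aeval_esymm_eq_multiset_esymm (Fin d) ℝ, hes j hjd]
  have := congrArg Polynomial.roots hprod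
  rwa [Polynomial.roots_multiset_prod_X_sub_C, Polynomial.roots_multiset_prod_X_sub_C] at this

theorem range_subset_of_signed_sum_pow_eq {d : ℕ} (e : Fin d → ℝ) (he : ∀ k, e k = 1 ∨ e k = -1)
    (s t : Fin d → ℝ) (hs : Function.Injective s)
    (h : ∀ i : Fin d, ∑ k, e k * s k ^ ((i : ℕ) + 1) = ∑ k, e k * t k ^ ((i : ℕ) + 1)) :
    Set.range s ⊆ Set.range t := by
  classical
  let x : Fin d → ℝ := fun k => if e k = 1 then s k else t k
  let y : Fin d → ℝ := fun k => if e k = 1 then t k else s k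
  have hxy := multiset_map_eq_of_sum_pow_eq x y (by
    intro q hq hqd
    have := h ⟨q - 1, by omega⟩
    simp only [Nat.sub_add_cancel hq] at this
    rw [← sub_eq_zero, ← Finset.sum_sub_distrib] at this ⊢
    rw [← this]
    refine Finset.sum_congr rfl fun k _ => ?_
    rcases he k with hk | hk
    · simp [x, y, hk]
    · norm_num [x, y, hk]
      ring)
  rintro _ ⟨k, rfl⟩
  by_contra hk
  have hkt : ∀ j, t j ≠ s k := fun j hj => hk ⟨j, hj⟩
  have hcount := congrArg (Multiset.count (s k)) hxy
  have hmem : s k ∈ Multiset.map x Finset.univ.val ↔ s k ∈ Multiset.map y Finset.univ.val := by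
    rw [hxy]
  simp only [Multiset.mem_map, Finset.mem_val, Finset.mem_univ, true_and] at hmem
  rcases he k with hek | hek
  · obtain ⟨j, hj⟩ := hmem.1 ⟨k, by simp [x, hek]⟩
    simp only [y] at hj
    split_ifs at hj with hej
    · exact hkt j hj
    · exact hej (hs hj ▸ hek)
  · obtain ⟨j, hj⟩ := hmem.2 ⟨k, by norm_num [y, hek]⟩
    simp only [x] at hj
    split_ifs at hj with hej
    · rw [hs hj, hek] at hej
      norm_num at hej
    · exact hkt j hj

/-- The signed moment map is injective on each ordering region. -/
theorem eq_of_signed_sum_pow_eq {d : ℕ} (e : Fin d → ℝ) (he : ∀ k, e k = 1 ∨ e k = -1)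
    (π : Equiv.Perm (Fin d)) (s t : Fin d → ℝ) (hs : StrictMono (s ∘ π)) (ht : StrictMono (t ∘ π))
    (h : ∀ i : Fin d, ∑ k, e k * s k ^ ((i : ℕ) + 1) = ∑ k, e k * t k ^ ((i : ℕ) + 1)) :
    s = t := by
  have hs' : Function.Injective s := by
    have := hs.injective.comp π.symm.injective
    simpa [Function.comp_assoc] using this
  have ht' : Function.Injective t := by
    have := ht.injective.comp π.symm.injective
    simpa [Function.comp_assoc] using this
  have hr : Set.range s = Set.range t :=
    (range_subset_of_signed_sum_pow_eq e he s t hs' h).antisymm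
      (range_subset_of_signed_sum_pow_eq e he t s ht' fun i => (h i).symm)
  have : s ∘ π = t ∘ π := by
    refine (StrictMono.range_inj hs ht).1 ?_
    rw [EquivLike.range_comp, EquivLike.range_comp, hr]
  funext k
  simpa using congrFun this (π.symm k)

/-- The signed moment map `s ↦ ∑ k, e k * c i * s k ^ (i + 1)`. -/
def momentMap {d : ℕ} (e c : Fin d → ℝ) (s : Fin d → ℝ) : Fin d → ℝ :=
  fun i => ∑ k, e k * (c i * s k ^ ((i : ℕ) + 1))

theorem hasFDerivAt_momentMap {d : ℕ} (e c s : Fin d → ℝ) :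
    HasFDerivAt (momentMap e c) (LinearMap.toContinuousLinearMap (Matrix.toLin'
      (Matrix.of fun i k => e k * (c i * (((i : ℕ) + 1) * s k ^ (i : ℕ)))))) s := by
  have h1 : HasFDerivAt (momentMap e c) (ContinuousLinearMap.pi fun i => ∑ k,
      (e k * (c i * (((i : ℕ) + 1) * s k ^ (i : ℕ)))) •
        (ContinuousLinearMap.proj k : (Fin d → ℝ) →L[ℝ] ℝ)) s := by
    refine hasFDerivAt_pi.2 fun i => ?_
    refine HasFDerivAt.fun_sum fun k _ => ?_
    have h2 : HasDerivAt (fun t : ℝ => e k * (c i * t ^ ((i : ℕ) + 1)))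
        (e k * (c i * (((i : ℕ) + 1) * s k ^ (i : ℕ)))) (s k) := by
      have := ((hasDerivAt_pow ((i : ℕ) + 1) (s k)).const_mul (c i)).const_mul (e k)
      simpa using this
    have h3 : HasFDerivAt (fun s' : Fin d → ℝ => s' k)
        (ContinuousLinearMap.proj k : (Fin d → ℝ) →L[ℝ] ℝ) s := hasFDerivAt_apply k s
    exact HasDerivAt.comp_hasFDerivAt (f := fun s' : Fin d → ℝ => s' k) s h2 h3
  refine h1.congr_fderiv ?_
  ext v i
  simp [Matrix.mulVec, dotProduct]

theorem det_momentMatrix {d : ℕ} (e c s : Fin d → ℝ) :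
    (Matrix.of fun i k : Fin d => e k * (c i * (((i : ℕ) + 1) * s k ^ (i : ℕ)))).det =
      (∏ k, e k) * ((∏ i : Fin d, c i * ((i : ℕ) + 1)) * ∏ k, ∏ l ∈ Finset.Ioi k, (s l - s k)) := by
  rw [← Matrix.det_vandermonde, ← Matrix.det_transpose (Matrix.vandermonde s),
    ← Matrix.det_mul_column, ← Matrix.det_mul_row]
  congr 1
  ext i k
  simp only [Matrix.of_apply, Matrix.transpose_apply, Matrix.vandermonde_apply]
  ring

theorem le_abs_det_momentMatrix {d : ℕ} (e c s : Fin d → ℝ) (he : ∀ k, e k = 1 ∨ e k = -1)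
    {κ θ : ℝ} (hκ : 0 < κ) (hc : ∀ i, κ ≤ c i) (hθ : 0 < θ) (hθ1 : θ ≤ 1)
    (hs : ∀ k l, k ≠ l → θ ≤ |s k - s l|) :
    κ ^ d * θ ^ (d * d) ≤ |(Matrix.of fun i k : Fin d =>
      e k * (c i * (((i : ℕ) + 1) * s k ^ (i : ℕ)))).det| := by
  rw [det_momentMatrix, abs_mul, abs_mul, Finset.abs_prod, Finset.abs_prod, Finset.abs_prod]
  have h1 : ∏ k, |e k| = 1 := Finset.prod_eq_one fun k _ => by
    rcases he k with h | h <;> simp [h]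
  rw [h1, one_mul]
  refine mul_le_mul ?_ ?_ (by positivity) (Finset.prod_nonneg fun _ _ => abs_nonneg _)
  · calc κ ^ d = ∏ _i : Fin d, κ := by simp
      _ ≤ _ := by
        refine Finset.prod_le_prod (fun _ _ => hκ.le) fun i _ => ?_
        have := hc i
        rw [abs_of_nonneg (by have := hκ.trans_le this; positivity)]
        nlinarith [(Nat.cast_nonneg (i : ℕ) : (0 : ℝ) ≤ (i : ℕ))]
  · calc θ ^ (d * d) = ∏ _k : Fin d, θ ^ d := by simp [pow_mul]
      _ ≤ _ := by
        refine Finset.prod_le_prod (fun _ _ => by positivity) fun k _ => ?_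
        rw [Finset.abs_prod]
        calc θ ^ d ≤ θ ^ (Finset.Ioi k).card := by
              refine pow_le_pow_of_le_one hθ.le hθ1 ?_
              simpa using Finset.card_le_univ (Finset.Ioi k)
          _ = ∏ _l ∈ Finset.Ioi k, θ := by simp
          _ ≤ _ := Finset.prod_le_prod (fun _ _ => hθ.le) fun l hl =>
              hs l k (Finset.mem_Ioi.1 hl).ne'

theorem volume_eq_lintegral_insertNth {n : ℕ} (k : Fin (n + 1)) {X : Set (Fin (n + 1) → ℝ)}
    (hX : MeasurableSet X) :
    volume X = ∫⁻ q : Fin n → ℝ, volume {t : ℝ | (k.insertNth t q : Fin (n + 1) → ℝ) ∈ X} := by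
  have hmp := (volume_preserving_piFinSuccAbove (fun _ : Fin (n + 1) => ℝ) k).symm
  have h := hmp.measure_preimage_equiv X
  rw [← h, Measure.volume_eq_prod, Measure.prod_apply_symm
    ((MeasurableEquiv.measurable _) hX)]
  rfl

theorem volume_eq_lintegral_cons {n : ℕ} {X : Set (Fin (n + 1) → ℝ)} (hX : MeasurableSet X) :
    volume X = ∫⁻ t : ℝ, volume {q : Fin n → ℝ | (Fin.cons t q : Fin (n + 1) → ℝ) ∈ X} := by
  have hmp := (volume_preserving_piFinSuccAbove (fun _ : Fin (n + 1) => ℝ) 0).symm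
  have h := hmp.measure_preimage_equiv X
  rw [← h, Measure.volume_eq_prod, Measure.prod_apply
    ((MeasurableEquiv.measurable _) hX)]
  refine lintegral_congr fun t => ?_
  congr 1
  ext q
  simp [MeasurableEquiv.piFinSuccAbove, Fin.insertNthEquiv]

theorem volume_box {n : ℕ} (L : ℝ) :
    volume {q : Fin n → ℝ | ∀ i, q i ∈ Set.Icc (0 : ℝ) L} = ENNReal.ofReal L ^ n := by
  have : {q : Fin n → ℝ | ∀ i, q i ∈ Set.Icc (0 : ℝ) L} =
      Set.univ.pi fun _ => Set.Icc (0 : ℝ) L := by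
    ext q
    simp only [Set.mem_ofPred_eq, Set.mem_pi, Set.mem_univ, forall_true_left]
  rw [this, volume_pi_pi]
  simp

theorem measurableSet_box {n : ℕ} (L : ℝ) :
    MeasurableSet {q : Fin n → ℝ | ∀ i, q i ∈ Set.Icc (0 : ℝ) L} := by
  simp only [Set.ofPred_forall]
  exact MeasurableSet.iInter fun i => (measurable_pi_apply i) measurableSet_Icc

/-- A bound for volumes from a bound for the fibres in one direction. -/
theorem volume_le_of_fibre_le {n : ℕ} (k : Fin (n + 1)) {X : Set (Fin (n + 1) → ℝ)}
    (hX : MeasurableSet X) {L : ℝ} {a : ENNReal}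
    (hbox : ∀ x ∈ X, ∀ j, x (Fin.succAbove k j) ∈ Set.Icc (0 : ℝ) L)
    (ha : ∀ q : Fin n → ℝ, volume {t : ℝ | (k.insertNth t q : Fin (n + 1) → ℝ) ∈ X} ≤ a) :
    volume X ≤ a * ENNReal.ofReal L ^ n := by
  rw [volume_eq_lintegral_insertNth k hX, ← volume_box (n := n),
    ← lintegral_indicator_const (measurableSet_box L)]
  refine lintegral_mono fun q => ?_
  by_cases hq : q ∈ {q : Fin n → ℝ | ∀ i, q i ∈ Set.Icc (0 : ℝ) L}
  · rw [Set.indicator_of_mem hq]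
    exact ha q
  · rw [Set.indicator_of_notMem hq, nonpos_iff_eq_zero]
    convert measure_empty (μ := (volume : Measure ℝ))
    refine Set.eq_empty_of_forall_notMem fun t ht => hq fun i => ?_
    simpa using hbox _ ht i

/-- The measure of the set of `k`-step walks from `p`, along steps `γ a s` with `s ∈ I` leaving the
side `a`, that end in the set `V`. -/
def walkMass {d : ℕ} (V : Bool → Set (Fin d → ℝ)) (γ : Bool → ℝ → Fin d → ℝ) (I : Set ℝ) :
    ℕ → Bool → (Fin d → ℝ) → ENNReal
  | 0, a, p => (V a).indicator 1 p
  | k + 1, a, p => ∫⁻ s in I, walkMass V γ I k (!a) (p + γ a s)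

theorem measurable_walkMass {d : ℕ} {V : Bool → Set (Fin d → ℝ)} (hV : ∀ a, MeasurableSet (V a))
    {γ : Bool → ℝ → Fin d → ℝ} (hγ : ∀ a, Measurable (γ a)) (I : Set ℝ) (k : ℕ) :
    ∀ a, Measurable (walkMass V γ I k a) := by
  induction k with
  | zero => exact fun a => measurable_one.indicator (hV a)
  | succ k ih =>
    intro a
    have : Measurable fun z : (Fin d → ℝ) × ℝ => walkMass V γ I k (!a) (z.1 + γ a z.2) :=
      (ih _).comp (measurable_fst.add ((hγ a).comp measurable_snd))
    exact this.lintegral_prod_right'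

/-- Edges starting at points with few `k`-step walks form a small set. -/
theorem volume_edges_walkMass_lt_le {d : ℕ} {V : Bool → Set (Fin d → ℝ)}
    (hV : ∀ a, MeasurableSet (V a)) {γ : Bool → ℝ → Fin d → ℝ} (hγ : ∀ a, Measurable (γ a))
    (hneg : ∀ a s, γ (!a) s = -γ a s) {I : Set ℝ} (hI : MeasurableSet I) {δ v : ENNReal}
    (hv : ∀ a, volume (V a) ≤ v) (k : ℕ) :
    ∀ a, volume {z : ℝ × (Fin d → ℝ) | z.1 ∈ I ∧ z.2 ∈ V a ∧ z.2 + γ a z.1 ∈ V (!a) ∧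
      walkMass V γ I k a z.2 < δ ^ k} ≤ k * δ * v := by
  have hmeas : ∀ k a, MeasurableSet {z : ℝ × (Fin d → ℝ) | z.1 ∈ I ∧ z.2 ∈ V a ∧
      z.2 + γ a z.1 ∈ V (!a) ∧ walkMass V γ I k a z.2 < δ ^ k} := fun k a =>
    (measurable_fst hI).inter ((measurable_snd (hV a)).inter
      (((measurable_snd.add ((hγ a).comp measurable_fst)) (hV (!a))).inter
        (measurableSet_lt ((measurable_walkMass hV hγ I k a).comp measurable_snd)
          measurable_const)))
  induction k with
  | zero =>
    intro a
    rw [Set.eq_empty_of_forall_notMem (s := {z : ℝ × (Fin d → ℝ) | _})]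
    · simp
    · rintro z ⟨-, h, -, h'⟩
      simp [walkMass, h] at h'
  | succ k ih =>
    intro a
    let shear : ℝ × (Fin d → ℝ) → ℝ × (Fin d → ℝ) := fun z => (z.1, z.2 + γ a z.1)
    have hshear : MeasurePreserving shear :=
      (MeasurePreserving.id volume).skew_product (g := fun s p => p + γ a s)
        (measurable_snd.add ((hγ a).comp measurable_fst))
        (Filter.Eventually.of_forall fun s => map_add_right_eq_self volume (γ a s))
    have hcover : {z : ℝ × (Fin d → ℝ) | z.1 ∈ I ∧ z.2 ∈ V a ∧ z.2 + γ a z.1 ∈ V (!a) ∧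
        walkMass V γ I (k + 1) a z.2 < δ ^ (k + 1)} ⊆
        shear ⁻¹' {z | z.1 ∈ I ∧ z.2 ∈ V (!a) ∧ z.2 + γ (!a) z.1 ∈ V (!(!a)) ∧
          walkMass V γ I k (!a) z.2 < δ ^ k} ∪
        {z | z.2 ∈ V a ∧ z.1 ∈ I ∧ δ ^ k ≤ walkMass V γ I k (!a) (z.2 + γ a z.1) ∧
          walkMass V γ I (k + 1) a z.2 < δ ^ (k + 1)} := by
      rintro z ⟨h1, h2, h3, h4⟩
      by_cases h5 : walkMass V γ I k (!a) (z.2 + γ a z.1) < δ ^ k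
      · exact Or.inl ⟨h1, h3, by simpa [shear, hneg] using h2, h5⟩
      · exact Or.inr ⟨h2, h1, not_lt.1 h5, h4⟩
    have hmw : Measurable fun z : ℝ × (Fin d → ℝ) => walkMass V γ I k (!a) (z.2 + γ a z.1) :=
      (measurable_walkMass hV hγ I k _).comp
        (measurable_snd.add ((hγ a).comp measurable_fst))
    have hgood : volume {z : ℝ × (Fin d → ℝ) | z.2 ∈ V a ∧ z.1 ∈ I ∧
        δ ^ k ≤ walkMass V γ I k (!a) (z.2 + γ a z.1) ∧
          walkMass V γ I (k + 1) a z.2 < δ ^ (k + 1)} ≤ δ * v := by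
      rw [Measure.volume_eq_prod, Measure.prod_apply_symm]
      · calc _ ≤ ∫⁻ p, (V a).indicator (fun _ => δ) p := by
              refine lintegral_mono fun p => ?_
              by_cases hp : p ∈ V a ∧ walkMass V γ I (k + 1) a p < δ ^ (k + 1)
              · rw [Set.indicator_of_mem hp.1]
                have hm := mul_meas_ge_le_lintegral (μ := volume.restrict I)
                  (hmw.comp (measurable_id.prodMk (measurable_const (a := p)))) (δ ^ k)
                have hlt := hm.trans_lt hp.2
                rw [pow_succ] at hlt
                have := lt_of_mul_lt_mul_left' hlt
                rw [Measure.restrict_apply' hI] at this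
                refine (measure_mono ?_).trans this.le
                rintro s ⟨-, hs1, hs2, -⟩
                exact ⟨hs2, hs1⟩
              · rw [show (fun s : ℝ => (s, p)) ⁻¹' {z : ℝ × (Fin d → ℝ) | z.2 ∈ V a ∧ z.1 ∈ I ∧
                  δ ^ k ≤ walkMass V γ I k (!a) (z.2 + γ a z.1) ∧
                    walkMass V γ I (k + 1) a z.2 < δ ^ (k + 1)} = ∅ from
                  Set.eq_empty_of_forall_notMem fun s hs => hp ⟨hs.1, hs.2.2.2⟩]
                simp
          _ = δ * volume (V a) := lintegral_indicator_const (hV a) δ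
          _ ≤ δ * v := by gcongr; exact hv a
      · exact (measurable_snd (hV a)).inter ((measurable_fst hI).inter
          ((measurableSet_le measurable_const hmw).inter (measurableSet_lt
            ((measurable_walkMass hV hγ I (k + 1) a).comp measurable_snd) measurable_const)))
    calc _ ≤ _ := measure_mono hcover
      _ ≤ _ := measure_union_le _ _
      _ ≤ k * δ * v + δ * v := by
        refine add_le_add ?_ hgood
        rw [hshear.measure_preimage (hmeas k (!a)).nullMeasurableSet]
        exact ih (!a)
      _ = _ := by push_cast; ring

/-- The mass of `k`-step walks is bounded by the volume of a set of parameters. -/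
theorem exists_walkMass_le_volume {d : ℕ} {V : Bool → Set (Fin d → ℝ)}
    (hV : ∀ a, MeasurableSet (V a)) {γ : Bool → ℝ → Fin d → ℝ} (hγ : ∀ a, Measurable (γ a))
    (hneg : ∀ a s, γ (!a) s = -γ a s) {I : Set ℝ} (hI : MeasurableSet I) (k : ℕ) :
    ∀ a, ∃ e : Fin k → ℝ, (∀ i, e i = 1 ∨ e i = -1) ∧ ∃ b, ∀ p,
      walkMass V γ I k a p ≤ volume {s : Fin k → ℝ | (∀ i, s i ∈ I) ∧
        p + ∑ i, e i • γ false (s i) ∈ V b} := by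
  induction k with
  | zero =>
    intro a
    refine ⟨Fin.elim0, fun i => i.elim0, a, fun p => ?_⟩
    by_cases hp : p ∈ V a
    · have : {s : Fin 0 → ℝ | (∀ i, s i ∈ I) ∧
          p + ∑ i, (Fin.elim0 i : ℝ) • γ false (s i) ∈ V a} = Set.univ := by
        ext s; simp [hp]
      rw [this, volume_pi, Measure.pi_univ]
      simp [walkMass, hp]
    · simp [walkMass, hp]
  | succ k ih =>
    intro a
    obtain ⟨e, he, b, hb⟩ := ih (!a)
    let ε : ℝ := if a = false then 1 else -1
    have hε : ∀ s, γ a s = ε • γ false s := by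
      intro s
      cases a
      · simp [ε]
      · simpa [ε] using hneg false s
    refine ⟨Fin.cons ε e, ?_, b, fun p => ?_⟩
    · refine Fin.cases ?_ ?_
      · cases a <;> simp [ε]
      · simpa using he
    · have hms : MeasurableSet {s : Fin (k + 1) → ℝ | (∀ i, s i ∈ I) ∧
          p + ∑ i, (Fin.cons ε e : Fin (k + 1) → ℝ) i • γ false (s i) ∈ V b} := by
        refine MeasurableSet.inter (s₁ := {s : Fin (k + 1) → ℝ | ∀ i, s i ∈ I}) ?_ ?_
        · simp only [Set.ofPred_forall]
          exact MeasurableSet.iInter fun i => (measurable_pi_apply i) hI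
        · have : Measurable fun s : Fin (k + 1) → ℝ =>
              p + ∑ i, (Fin.cons ε e : Fin (k + 1) → ℝ) i • γ false (s i) :=
            measurable_const.add (Finset.measurable_sum _ fun i _ =>
              ((hγ false).comp (measurable_pi_apply i)).const_smul
                ((Fin.cons ε e : Fin (k + 1) → ℝ) i))
          exact this (hV b)
      rw [volume_eq_lintegral_cons hms]
      refine le_trans ?_ (setLIntegral_le_lintegral I _)
      rw [walkMass]
      refine setLIntegral_mono' hI fun t ht => (hb _).trans (measure_mono ?_)
      rintro q ⟨hq1, hq2⟩
      refine ⟨Fin.cases ht hq1, ?_⟩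
      rw [Fin.sum_univ_succ]
      simpa [hε, add_assoc] using hq2

theorem abs_det_fderiv_momentMap {d : ℕ} (e c s : Fin d → ℝ) (he : ∀ k, e k = 1 ∨ e k = -1)
    {κ θ : ℝ} (hκ : 0 < κ) (hc : ∀ i, κ ≤ c i) (hθ : 0 < θ) (hθ1 : θ ≤ 1)
    (hs : ∀ k l, k ≠ l → θ ≤ |s k - s l|) :
    κ ^ d * θ ^ (d * d) ≤ |(LinearMap.toContinuousLinearMap (Matrix.toLin'
      (Matrix.of fun i k : Fin d => e k * (c i * (((i : ℕ) + 1) * s k ^ (i : ℕ)))))).det| := by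
  have := le_abs_det_momentMatrix e c s he hκ hc hθ hθ1 hs
  rwa [ContinuousLinearMap.det, LinearMap.coe_toContinuousLinearMap, LinearMap.det_toLin']

theorem volume_momentMap_preimage_ordered_le {d : ℕ} (e c p : Fin d → ℝ)
    (he : ∀ k, e k = 1 ∨ e k = -1) {κ θ : ℝ} (hκ : 0 < κ) (hc : ∀ i, κ ≤ c i) (hθ : 0 < θ)
    (hθ1 : θ ≤ 1) {V : Set (Fin d → ℝ)} (hV : MeasurableSet V) (π : Equiv.Perm (Fin d)) :
    ENNReal.ofReal (κ ^ d * θ ^ (d * d)) * volume {s : Fin d → ℝ | StrictMono (s ∘ π) ∧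
      (∀ k l, k ≠ l → θ ≤ |s k - s l|) ∧ p + momentMap e c s ∈ V} ≤ volume V := by
  set N : Set (Fin d → ℝ) := {s | StrictMono (s ∘ π) ∧
      (∀ k l, k ≠ l → θ ≤ |s k - s l|) ∧ p + momentMap e c s ∈ V} with hN
  have hderiv : ∀ s, HasFDerivAt (fun s => p + momentMap e c s) _ s := fun s =>
    (hasFDerivAt_momentMap e c s).const_add p
  have hcont : Continuous fun s => p + momentMap e c s :=
    continuous_iff_continuousAt.2 fun s => (hderiv s).continuousAt
  have hNm : MeasurableSet N := by
    refine MeasurableSet.inter ?_ (MeasurableSet.inter ?_ (hcont.measurable hV))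
    · have : {s : Fin d → ℝ | StrictMono (s ∘ π)} =
          {s | ∀ i j, i < j → s (π i) < s (π j)} := rfl
      change MeasurableSet {s : Fin d → ℝ | StrictMono (s ∘ π)}
      rw [this]
      simp only [Set.ofPred_forall]
      exact MeasurableSet.iInter fun i => MeasurableSet.iInter fun j => MeasurableSet.iInter
        fun _ => measurableSet_lt (measurable_pi_apply _) (measurable_pi_apply _)
    · change MeasurableSet {s : Fin d → ℝ | ∀ k l, k ≠ l → θ ≤ |s k - s l|}
      simp only [Set.ofPred_forall]
      exact MeasurableSet.iInter fun k => MeasurableSet.iInter fun l => MeasurableSet.iInter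
        fun _ => measurableSet_le measurable_const
          (continuous_abs.measurable.comp ((measurable_pi_apply k).sub (measurable_pi_apply l)))
  have hinj : Set.InjOn (fun s => p + momentMap e c s) N := by
    rintro s hs t ht hst
    refine eq_of_signed_sum_pow_eq e he π s t hs.1 ht.1 fun i => ?_
    have h1 := congrFun (add_left_cancel hst) i
    simp only [momentMap] at h1
    have hci : c i ≠ 0 := (hκ.trans_le (hc i)).ne'
    have h2 : ∀ u : Fin d → ℝ, ∑ k, e k * (c i * u k ^ ((i : ℕ) + 1)) =
        c i * ∑ k, e k * u k ^ ((i : ℕ) + 1) := fun u => by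
      rw [Finset.mul_sum]
      exact Finset.sum_congr rfl fun k _ => by ring
    rw [h2, h2] at h1
    exact mul_left_cancel₀ hci h1
  have himage := lintegral_abs_det_fderiv_eq_addHaar_image volume hNm
    (fun s _ => (hderiv s).hasFDerivWithinAt) hinj
  calc _ = ∫⁻ _ in N, ENNReal.ofReal (κ ^ d * θ ^ (d * d)) := by rw [setLIntegral_const]
    _ ≤ _ := setLIntegral_mono' hNm fun s hs => ENNReal.ofReal_le_ofReal
      (abs_det_fderiv_momentMap e c s he hκ hc hθ hθ1 hs.2.1)
    _ = _ := himage
    _ ≤ volume V := measure_mono (by rintro _ ⟨s, hs, rfl⟩; exact hs.2.2)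

/-- The set of parameters for which a signed moment curve sum lands in a small set is small. -/
theorem volume_momentMap_preimage_le {m : ℕ} (e c p : Fin (m + 1) → ℝ)
    (he : ∀ k, e k = 1 ∨ e k = -1) {κ θ : ℝ} (hκ : 0 < κ) (hc : ∀ i, κ ≤ c i) (hθ : 0 < θ)
    (hθ1 : θ ≤ 1) {V : Set (Fin (m + 1) → ℝ)} (hV : MeasurableSet V) {v : ENNReal}
    (hv : volume V ≤ v) (L : ℝ) :
    volume {s : Fin (m + 1) → ℝ | (∀ i, s i ∈ Set.Icc (0 : ℝ) L) ∧ p + momentMap e c s ∈ V} ≤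
      (m + 1).factorial * (v / ENNReal.ofReal (κ ^ (m + 1) * θ ^ ((m + 1) * (m + 1)))) +
        (m + 1 : ℕ) * (m + 1 : ℕ) * (ENNReal.ofReal (2 * θ) * ENNReal.ofReal L ^ m) := by
  have hcover : {s : Fin (m + 1) → ℝ | (∀ i, s i ∈ Set.Icc (0 : ℝ) L) ∧
      p + momentMap e c s ∈ V} ⊆
      (⋃ π : Equiv.Perm (Fin (m + 1)), {s | StrictMono (s ∘ π) ∧
        (∀ k l, k ≠ l → θ ≤ |s k - s l|) ∧ p + momentMap e c s ∈ V}) ∪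
      ⋃ kl : Fin (m + 1) × Fin (m + 1), {s | (∀ i, s i ∈ Set.Icc (0 : ℝ) L) ∧ kl.1 ≠ kl.2 ∧
        |s kl.1 - s kl.2| < θ} := by
    rintro s ⟨hs, hsV⟩
    by_cases hsep : ∀ k l, k ≠ l → θ ≤ |s k - s l|
    · left
      have hinj : Function.Injective s := by
        intro k l hkl
        by_contra hne
        have := hsep k l hne
        rw [hkl, sub_self, abs_zero] at this
        linarith
      exact Set.mem_iUnion.2 ⟨Tuple.sort s, (Tuple.monotone_sort s).strictMono_of_injective
        (hinj.comp (Tuple.sort s).injective), hsep, hsV⟩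
    · right
      push Not at hsep
      obtain ⟨k, l, hkl, hlt⟩ := hsep
      exact Set.mem_iUnion.2 ⟨(k, l), hs, hkl, hlt⟩
  have hdeg : ∀ kl : Fin (m + 1) × Fin (m + 1), volume {s : Fin (m + 1) → ℝ |
      (∀ i, s i ∈ Set.Icc (0 : ℝ) L) ∧ kl.1 ≠ kl.2 ∧ |s kl.1 - s kl.2| < θ} ≤
        ENNReal.ofReal (2 * θ) * ENNReal.ofReal L ^ m := by
    rintro ⟨k, l⟩
    refine volume_le_of_fibre_le k ?_ (fun x hx j => hx.1 _) fun q => ?_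
    · refine (measurableSet_box L).inter ((MeasurableSet.const _).inter ?_)
      exact measurableSet_lt (continuous_abs.measurable.comp
        ((measurable_pi_apply k).sub (measurable_pi_apply l))) measurable_const
    · by_cases hkl : k = l
      · rw [Set.eq_empty_of_forall_notMem (s := {t : ℝ | _}) fun t ht => ht.2.1 hkl]
        simp
      · obtain ⟨j, rfl⟩ := Fin.exists_succAbove_eq (Ne.symm hkl)
        rw [← Real.volume_ball (q j) θ]
        refine measure_mono fun t ht => ?_
        have := ht.2.2
        simpa [Real.dist_eq] using this
  have hpos : 0 < κ ^ (m + 1) * θ ^ ((m + 1) * (m + 1)) := by positivity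
  refine (measure_mono hcover).trans ((measure_union_le _ _).trans (add_le_add ?_ ?_))
  · refine (measure_iUnion_fintype_le _ _).trans ?_
    calc _ ≤ ∑ _π : Equiv.Perm (Fin (m + 1)),
          v / ENNReal.ofReal (κ ^ (m + 1) * θ ^ ((m + 1) * (m + 1))) := by
            refine Finset.sum_le_sum fun π _ => ?_
            rw [ENNReal.le_div_iff_mul_le (Or.inl (by simpa using hpos)) (Or.inl (by simp)),
              mul_comm]
            exact (volume_momentMap_preimage_ordered_le e c p he hκ hc hθ hθ1 hV π).trans hv
      _ = _ := by simp [Fintype.card_perm]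
  · refine (measure_iUnion_fintype_le _ _).trans ((Finset.sum_le_sum fun kl _ => hdeg kl).trans ?_)
    simp

/-- The weighted moment curve `s ↦ (c i * s ^ (i + 1))ᵢ`. -/
def momentCurve {d : ℕ} (c : Fin d → ℝ) (s : ℝ) : Fin d → ℝ := fun i => c i * s ^ ((i : ℕ) + 1)

theorem continuous_momentCurve {d : ℕ} (c : Fin d → ℝ) : Continuous (momentCurve c) := by
  unfold momentCurve
  fun_prop

theorem sum_smul_momentCurve {d : ℕ} (e c s : Fin d → ℝ) :
    ∑ k, e k • momentCurve c (s k) = momentMap e c s := by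
  ext i
  simp [momentMap, momentCurve]

theorem volume_edges_le {m : ℕ} (c : Fin (m + 1) → ℝ) {κ θ : ℝ} (hκ : 0 < κ) (hc : ∀ i, κ ≤ c i)
    (hθ : 0 < θ) (hθ1 : θ ≤ 1) {V : Bool → Set (Fin (m + 1) → ℝ)} (hV : ∀ a, MeasurableSet (V a))
    {v δ : ENNReal} (hv : ∀ a, volume (V a) ≤ v) (L : ℝ)
    (hδ : (m + 1).factorial * (v / ENNReal.ofReal (κ ^ (m + 1) * θ ^ ((m + 1) * (m + 1)))) +
        (m + 1 : ℕ) * (m + 1 : ℕ) * (ENNReal.ofReal (2 * θ) * ENNReal.ofReal L ^ m) <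
          δ ^ (m + 1)) :
    volume {z : ℝ × (Fin (m + 1) → ℝ) | z.1 ∈ Set.Icc (0 : ℝ) L ∧ z.2 ∈ V false ∧
      z.2 + momentCurve c z.1 ∈ V true} ≤ (m + 1 : ℕ) * δ * v := by
  let γ : Bool → ℝ → Fin (m + 1) → ℝ := fun a s => if a then -momentCurve c s else momentCurve c s
  have hγ : ∀ a, Measurable (γ a) := by
    intro a
    cases a
    · simpa [γ] using (continuous_momentCurve c).measurable
    · simp only [γ, if_true]
      exact (continuous_momentCurve c).neg.measurable
  have hneg : ∀ a s, γ (!a) s = -γ a s := by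
    intro a s
    cases a <;> simp [γ]
  obtain ⟨e, he, b, hb⟩ := exists_walkMass_le_volume hV hγ hneg
    (measurableSet_Icc (a := (0 : ℝ)) (b := L)) (m + 1) false
  refine (measure_mono ?_).trans (volume_edges_walkMass_lt_le hV hγ hneg
    (measurableSet_Icc (a := (0 : ℝ)) (b := L)) hv (m + 1) false)
  rintro ⟨s, p⟩ ⟨h1, h2, h3⟩
  refine ⟨h1, h2, by simpa [γ] using h3, (hb p).trans_lt ?_⟩
  have h := volume_momentMap_preimage_le e c p he hκ hc hθ hθ1 (hV b) (hv b) L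
  rw [← show (fun s => ∑ i, e i • γ false (s i)) = momentMap e c from
    funext fun s => by simpa [γ] using sum_smul_momentCurve e c s] at h
  exact h.trans_lt hδ

namespace SignClosed

/-- The points from which `X` can be reached by a forward move of length at most `r` in the
direction of coordinate `i`. -/
def sweep {n : ℕ} (X : Set (Fin n → ℝ)) (i : Fin n) (r : ℝ) : Set (Fin n → ℝ) :=
  {p | ∃ η ∈ Set.Icc (0 : ℝ) r, p + η • Pi.single i 1 ∈ X}

theorem isClosed_sweep {n B : ℕ} {X : Set (Fin n → ℝ)} (hX : SignClosed n B X) (i : Fin n)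
    (r : ℝ) : IsClosed (sweep X i r) := by
  have : sweep X i r = Prod.snd '' {z : Set.Icc (0 : ℝ) r × (Fin n → ℝ) |
      z.2 + (z.1 : ℝ) • Pi.single i 1 ∈ X} := by
    ext p
    constructor
    · rintro ⟨η, hη, h⟩
      exact ⟨(⟨η, hη⟩, p), h, rfl⟩
    · rintro ⟨⟨η, p⟩, h, rfl⟩
      exact ⟨η, η.2, h⟩
  rw [this]
  refine isClosedMap_snd_of_compactSpace _ (hX.isClosed.preimage ?_)
  fun_prop

theorem volume_sweep_le {n B : ℕ} {X : Set (Fin (n + 1) → ℝ)} (hX : SignClosed (n + 1) B X)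
    {L : ℝ} (hL : ∀ x ∈ X, ∀ i, x i ∈ Set.Icc (0 : ℝ) L) (i : Fin (n + 1)) (r : ℝ) :
    volume (sweep X i r) ≤ volume X + ENNReal.ofReal (B * r) * ENNReal.ofReal L ^ n := by
  have hcover : sweep X i r ⊆ X ∪ (sweep X i r \ X) := fun p hp => by
    by_cases h : p ∈ X
    · exact Or.inl h
    · exact Or.inr ⟨hp, h⟩
  refine (measure_mono hcover).trans ((measure_union_le _ _).trans (add_le_add le_rfl ?_))
  refine volume_le_of_fibre_le i ((isClosed_sweep hX i r).measurableSet.diff hX.measurableSet)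
    ?_ fun q => ?_
  · rintro x ⟨⟨η, -, hx⟩, -⟩ j
    simpa using hL _ hx (i.succAbove j)
  · have h := hX.volume_exit_le (i.insertNth 0 q : Fin (n + 1) → ℝ) (Pi.single i 1) r
    have hpt : ∀ t : ℝ, (i.insertNth 0 q : Fin (n + 1) → ℝ) + t • Pi.single i 1 =
        i.insertNth t q := by
      intro t
      ext j
      refine Fin.succAboveCases i ?_ (fun j => ?_) j <;> simp
    refine (measure_mono ?_).trans h
    rintro t ⟨⟨η, hη, h1⟩, h2⟩
    refine ⟨by rwa [hpt], η, hη, ?_⟩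
    rwa [add_smul, ← add_assoc, hpt]

end SignClosed

theorem volume_prod_eq_volume_cons {n : ℕ} {X : Set (Fin (n + 1) → ℝ)} (hX : MeasurableSet X) :
    volume {z : ℝ × (Fin n → ℝ) | (Fin.cons z.1 z.2 : Fin (n + 1) → ℝ) ∈ X} = volume X := by
  rw [volume_eq_lintegral_cons hX, Measure.volume_eq_prod, Measure.prod_apply]
  · rfl
  · have : Measurable fun z : ℝ × (Fin n → ℝ) => (Fin.cons z.1 z.2 : Fin (n + 1) → ℝ) :=
      measurable_pi_lambda _ fun i => Fin.cases measurable_fst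
        (fun j => (measurable_pi_apply j).comp measurable_snd) i
    exact this hX

/-- If every fibre over a projection contains a set of measure `a`, the projection is small. -/
theorem mul_volume_image_le {n : ℕ} (k : Fin (n + 1)) {X : Set (Fin (n + 1) → ℝ)}
    (hX : MeasurableSet X) (Y : Set (Fin n → ℝ)) (a : ENNReal)
    (h : ∀ q ∈ Y, a ≤ volume {t : ℝ | (k.insertNth t q : Fin (n + 1) → ℝ) ∈ X}) :
    a * volume Y ≤ volume X := by
  rw [volume_eq_lintegral_insertNth k hX]
  have hm : Measurable fun q : Fin n → ℝ =>
      volume {t : ℝ | (k.insertNth t q : Fin (n + 1) → ℝ) ∈ X} := by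
    have h1 : Measurable fun z : (Fin n → ℝ) × ℝ => (k.insertNth z.2 z.1 : Fin (n + 1) → ℝ) :=
      measurable_pi_lambda _ fun i => by
        refine Fin.succAboveCases k ?_ (fun j => ?_) i
        · simpa using measurable_snd
        · simpa [Function.comp_def] using
            (measurable_pi_apply j).comp (measurable_fst (α := Fin n → ℝ) (β := ℝ))
    exact measurable_measure_prodMk_left (h1 hX)
  refine le_trans ?_ (mul_meas_ge_le_lintegral hm a)
  gcongr
  exact h

theorem exists_walk_parameters (m : ℕ) : ∃ a : ℝ, 0 < a ∧ ∃ Q : ℕ, ∀ y B L r : ℝ, 0 < y → y ≤ 1 →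
    0 ≤ B → B * y ≤ 1 → 1 ≤ L → L * y ≤ 1 → 0 < r → r ≤ a * y ^ Q →
    ∃ θ δ : ℝ, 0 < θ ∧ θ ≤ 1 ∧ 0 < δ ∧
      (m + 1).factorial * (r * (1 + B * L ^ m) / (y ^ (m + 1) * θ ^ ((m + 1) * (m + 1)))) +
        (m + 1 : ℕ) * (m + 1 : ℕ) * (2 * θ * L ^ m) < δ ^ (m + 1) ∧
      (m + 2) * (L + 2) ^ (m + 1) * ((m + 1 : ℕ) * δ * (1 + B * L ^ m)) < 1 ∧
      (m + 2) * (L + 2) ^ (m + 1) * r < 1 := by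
  set A : ℝ := 1 / (4 * (m + 2) ^ 2 * 3 ^ (m + 1)) with hA
  have hA0 : 0 < A := by positivity
  have hm0 : (0 : ℝ) ≤ m := Nat.cast_nonneg m
  have hA1 : A ≤ 1 := by
    rw [hA, div_le_one (by positivity)]
    have : (1 : ℝ) ≤ 3 ^ (m + 1) := one_le_pow₀ (by norm_num)
    nlinarith
  set T : ℝ := A ^ (m + 1) / (6 * (m + 1) ^ 2) with hT
  have hT0 : 0 < T := by positivity
  have hT1 : T ≤ 1 := by
    rw [hT, div_le_one (by positivity)]
    have : A ^ (m + 1) ≤ 1 := pow_le_one₀ hA0.le hA1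
    nlinarith
  refine ⟨A ^ (m + 1) * T ^ ((m + 1) * (m + 1)) / (6 * (m + 1).factorial), by positivity,
    (2 * m + 2) * (m + 1) + (m + 1) + ((2 * m + 2) * (m + 1) + m) * ((m + 1) * (m + 1)) + (m + 1),
    fun y B L r hy hy1 hB hBy hL hLy hr hra => ?_⟩
  set δ : ℝ := A * y ^ (2 * m + 2) with hδ
  set θ : ℝ := T * y ^ ((2 * m + 2) * (m + 1) + m) with hθ
  have hδ0 : 0 < δ := by positivity
  have hθ0 : 0 < θ := by positivity
  have hδ1 : δ ≤ 1 := mul_le_one₀ hA1 (by positivity) (pow_le_one₀ hy.le hy1)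
  have hθ1 : θ ≤ 1 := mul_le_one₀ hT1 (by positivity) (pow_le_one₀ hy.le hy1)
  have hf0 : (1 : ℝ) ≤ (m + 1).factorial := by
    exact_mod_cast Nat.one_le_iff_ne_zero.2 (Nat.factorial_ne_zero _)
  have hra' : r ≤ δ ^ (m + 1) * (y ^ (m + 1) * θ ^ ((m + 1) * (m + 1))) * y ^ (m + 1) /
      (6 * (m + 1).factorial) := by
    refine hra.trans (le_of_eq ?_)
    rw [hδ, hθ]
    simp only [mul_pow, ← pow_mul, pow_add]
    ring
  have hLm : L ^ m * y ^ m ≤ 1 := by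
    rw [← mul_pow]
    exact pow_le_one₀ (by positivity) hLy
  have hE : (1 + B * L ^ m) * y ^ (m + 1) ≤ 2 := by
    have h1 : B * L ^ m * y ^ (m + 1) ≤ 1 := by
      calc B * L ^ m * y ^ (m + 1) = (B * y) * (L ^ m * y ^ m) := by ring
        _ ≤ 1 := mul_le_one₀ hBy (by positivity) hLm
    have h2 : y ^ (m + 1) ≤ 1 := pow_le_one₀ hy.le hy1
    nlinarith
  have hE0 : 1 ≤ 1 + B * L ^ m := by
    have : 0 ≤ B * L ^ m := by positivity
    linarith
  have hL2 : (L + 2) ^ (m + 1) * y ^ (m + 1) ≤ 3 ^ (m + 1) := by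
    rw [← mul_pow]
    exact pow_le_pow_left₀ (by positivity) (by nlinarith) _
  have hmain : (m + 2) * (L + 2) ^ (m + 1) * ((m + 1 : ℕ) * δ * (1 + B * L ^ m)) < 1 := by
    have h1 : (m + 2) * (L + 2) ^ (m + 1) * ((m + 1 : ℕ) * δ * (1 + B * L ^ m)) =
        (m + 2) * (m + 1) * A * (((L + 2) ^ (m + 1) * y ^ (m + 1)) *
          ((1 + B * L ^ m) * y ^ (m + 1))) := by
      rw [hδ]
      push_cast
      ring
    rw [h1]
    calc _ ≤ (m + 2) * (m + 1) * A * (3 ^ (m + 1) * 2) := by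
          gcongr
      _ = ((m + 1) * 2) / (4 * (m + 2)) := by
          rw [hA]
          field_simp
      _ < 1 := by
          rw [div_lt_one (by positivity)]
          linarith
  refine ⟨θ, δ, hθ0, hθ1, hδ0, ?_, hmain, ?_⟩
  · have h1 : (m + 1).factorial * (r * (1 + B * L ^ m) /
        (y ^ (m + 1) * θ ^ ((m + 1) * (m + 1)))) ≤ δ ^ (m + 1) / 3 := by
      set D := y ^ (m + 1) * θ ^ ((m + 1) * (m + 1)) with hD
      have hD0 : 0 < D := by positivity
      rw [mul_div_assoc', div_le_iff₀ hD0]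
      calc ((m + 1).factorial : ℝ) * (r * (1 + B * L ^ m))
          ≤ (m + 1).factorial * ((δ ^ (m + 1) * D * y ^ (m + 1) / (6 * (m + 1).factorial)) *
              (1 + B * L ^ m)) := by gcongr
        _ = δ ^ (m + 1) * D / 6 * ((1 + B * L ^ m) * y ^ (m + 1)) := by field_simp
        _ ≤ δ ^ (m + 1) * D / 6 * 2 := by gcongr
        _ = δ ^ (m + 1) / 3 * D := by ring
    have h2 : (m + 1 : ℕ) * (m + 1 : ℕ) * (2 * θ * L ^ m) ≤ δ ^ (m + 1) / 3 := by
      calc ((m + 1 : ℕ) : ℝ) * (m + 1 : ℕ) * (2 * θ * L ^ m)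
          = δ ^ (m + 1) / 3 * (L ^ m * y ^ m) := by
            rw [hθ, hT, hδ]
            push_cast
            simp only [mul_pow, ← pow_mul, pow_add]
            field_simp
            ring
        _ ≤ δ ^ (m + 1) / 3 * 1 := by gcongr
        _ = _ := mul_one _
    have : 0 < δ ^ (m + 1) := by positivity
    linarith
  · have h1 : r ≤ δ := by
      calc r ≤ _ := hra'
        _ ≤ δ * (1 * 1) * 1 / 1 := by
            gcongr
            · exact pow_le_of_le_one hδ0.le hδ1 (by omega)
            · exact pow_le_one₀ hy.le hy1
            · exact pow_le_one₀ hθ0.le hθ1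
            · exact pow_le_one₀ hy.le hy1
            · linarith
        _ = δ := by ring
    refine lt_of_le_of_lt ?_ hmain
    gcongr
    calc r ≤ δ := h1
      _ = 1 * δ * 1 := by ring
      _ ≤ (m + 1 : ℕ) * δ * (1 + B * L ^ m) := by
          gcongr
          exact_mod_cast Nat.le_add_left 1 m

/-- The set of pairs (parameter, point) for which both the point and its translate along the moment
curve lie in prescribed sets. -/
def edgeSet {d : ℕ} (c : Fin d → ℝ) (L : ℝ) (S₀ S₁ : Set (Fin d → ℝ)) : Set (Fin (d + 1) → ℝ) :=
  {x | x 0 ∈ Set.Icc (0 : ℝ) L ∧ Fin.tail x ∈ S₀ ∧ Fin.tail x + momentCurve c (x 0) ∈ S₁}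

theorem signClosed_edgeSet {d B : ℕ} (c : Fin d → ℝ) (L : ℝ) {S₀ S₁ : Set (Fin d → ℝ)}
    (h₀ : SignClosed d B S₀) (h₁ : SignClosed d B S₁) :
    SignClosed (d + 1) (2 + (B + d * B)) (edgeSet c L S₀ S₁) := by
  have e1 := (SignClosed.halfspace (MvPolynomial.X (0 : Fin (d + 1)) : MvPolynomial _ ℝ)).mono
    (MvPolynomial.totalDegree_X (R := ℝ) (0 : Fin (d + 1))).le
  have e2 := (SignClosed.halfspace (MvPolynomial.C L - MvPolynomial.X (0 : Fin (d + 1)) :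
    MvPolynomial _ ℝ)).mono (B' := 1) ((MvPolynomial.totalDegree_sub _ _).trans (by simp))
  have e3 := h₀.preimage (m := d + 1) (e := 1) (fun i => MvPolynomial.X i.succ)
    (fun i => (MvPolynomial.totalDegree_X (R := ℝ) _).le)
  have e4 := h₁.preimage (m := d + 1) (e := d) (fun i => MvPolynomial.X i.succ +
    MvPolynomial.C (c i) * MvPolynomial.X 0 ^ ((i : ℕ) + 1)) (fun i => by
      have hi := i.isLt
      refine (MvPolynomial.totalDegree_add _ _).trans (max_le ?_ ?_)
      · rw [MvPolynomial.totalDegree_X]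
        omega
      · refine (MvPolynomial.totalDegree_mul _ _).trans ?_
        rw [MvPolynomial.totalDegree_C, MvPolynomial.totalDegree_X_pow]
        omega)
  have e5 := (e1.inter e2).inter (e3.inter e4)
  refine (show edgeSet c L S₀ S₁ = _ from ?_) ▸ e5.mono (by omega)
  ext x
  simp [edgeSet, Fin.tail_def, momentCurve, Pi.add_def, and_assoc]

theorem volume_projection_edgeSet_le {m B : ℕ} (c : Fin (m + 1) → ℝ) {L r θ δ κ : ℝ}
    (hκ : 0 < κ) (hc : ∀ i, κ ≤ c i) (hθ : 0 < θ) (hθ1 : θ ≤ 1) (hr : 0 < r) (hL : 0 ≤ L)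
    (hδ0 : 0 < δ)
    (hδ : (m + 1).factorial * (r * (1 + B * L ^ m) / (κ ^ (m + 1) * θ ^ ((m + 1) * (m + 1)))) +
        (m + 1 : ℕ) * (m + 1 : ℕ) * (2 * θ * L ^ m) < δ ^ (m + 1))
    {S : Bool → Set (Fin (m + 1) → ℝ)} (hS : ∀ a, SignClosed (m + 1) B (S a))
    (hbox : ∀ a, ∀ x ∈ S a, ∀ i, x i ∈ Set.Icc (0 : ℝ) L)
    (hvol : ∀ a, volume (S a) ≤ ENNReal.ofReal r) (i : Fin (m + 1)) :
    volume ((fun x : Fin (m + 2) → ℝ => fun j => x (i.succ.succAbove j)) ''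
      edgeSet c L (S false) (S true)) ≤ ENNReal.ofReal ((m + 1 : ℕ) * δ * (1 + B * L ^ m)) := by
  set V : Bool → Set (Fin (m + 1) → ℝ) := fun a => SignClosed.sweep (S a) i r with hV
  have hVm : ∀ a, MeasurableSet (V a) := fun a =>
    (SignClosed.isClosed_sweep (hS a) i r).measurableSet
  have hVv : ∀ a, volume (V a) ≤ ENNReal.ofReal (r * (1 + B * L ^ m)) := by
    intro a
    refine (SignClosed.volume_sweep_le (hS a) (hbox a) i r).trans ?_
    refine (add_le_add (hvol a) le_rfl).trans (le_of_eq ?_)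
    rw [← ENNReal.ofReal_pow hL, ← ENNReal.ofReal_mul (by positivity),
      ← ENNReal.ofReal_add hr.le (by positivity)]
    congr 1
    ring
  have hedge := volume_edges_le c hκ hc hθ hθ1 hVm hVv L (δ := ENNReal.ofReal δ) (by
    rw [← ENNReal.ofReal_pow hδ0.le, ← ENNReal.ofReal_pow hL,
      ← ENNReal.ofReal_div_of_pos (by positivity), ← ENNReal.ofReal_mul (by positivity),
      ← ENNReal.ofReal_natCast, ← ENNReal.ofReal_natCast, ← ENNReal.ofReal_mul (by positivity),
      ← ENNReal.ofReal_mul (by positivity), ← ENNReal.ofReal_mul (by positivity),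
      ← ENNReal.ofReal_add (by positivity) (by positivity),
      ENNReal.ofReal_lt_ofReal_iff (by positivity)]
    exact hδ)
  set E : Set (Fin (m + 2) → ℝ) := edgeSet c L (V false) (V true) with hE
  have hEm : MeasurableSet E := by
    have ht : Measurable fun x : Fin (m + 2) → ℝ => Fin.tail x :=
      measurable_pi_lambda _ fun j => measurable_pi_apply j.succ
    exact ((measurable_pi_apply 0) measurableSet_Icc).inter ((ht (hVm false)).inter
      ((ht.add ((continuous_momentCurve c).measurable.comp (measurable_pi_apply 0))) (hVm true)))
  have hEv : volume E ≤ (m + 1 : ℕ) * ENNReal.ofReal δ * ENNReal.ofReal (r * (1 + B * L ^ m)) := by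
    rw [← volume_prod_eq_volume_cons hEm]
    refine le_trans (le_of_eq ?_) hedge
    congr 1
  have hproj := mul_volume_image_le i.succ hEm
    ((fun x : Fin (m + 2) → ℝ => fun j => x (i.succ.succAbove j)) ''
      edgeSet c L (S false) (S true)) (ENNReal.ofReal r) (by
    rintro _ ⟨x, hx, rfl⟩
    calc ENNReal.ofReal r = volume (Set.Icc (x i.succ - r) (x i.succ)) := by simp
      _ ≤ _ := by
        refine measure_mono fun t ht => ?_
        have h0 : (i.succ.insertNth t fun j => x (i.succ.succAbove j) : Fin (m + 2) → ℝ) 0 =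
            x 0 := by
          have := Fin.insertNth_apply_succAbove (α := fun _ => ℝ) i.succ t
            (fun j => x (i.succ.succAbove j)) 0
          simpa using this
        have htail : Fin.tail (i.succ.insertNth t fun j => x (i.succ.succAbove j) :
            Fin (m + 2) → ℝ) + (x i.succ - t) • Pi.single i 1 = Fin.tail x := by
          ext j
          simp only [Fin.tail_def, Pi.add_apply, Pi.smul_apply, smul_eq_mul]
          by_cases hj : j = i
          · subst hj
            simp
          · obtain ⟨l, hl⟩ :=
              Fin.exists_succAbove_eq (x := j.succ) (y := i.succ) (by simpa using hj)
            rw [← hl, Fin.insertNth_apply_succAbove]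
            simp [hj]
        have hη : x i.succ - t ∈ Set.Icc (0 : ℝ) r := ⟨by linarith [ht.2], by linarith [ht.1]⟩
        refine ⟨by rw [h0]; exact hx.1, ⟨_, hη, by rw [htail]; exact hx.2.1⟩, ⟨_, hη, ?_⟩⟩
        rw [h0, add_right_comm, htail]
        exact hx.2.2)
  have h1 := hproj.trans hEv
  have h2 : ((m + 1 : ℕ) : ENNReal) * ENNReal.ofReal δ * ENNReal.ofReal (r * (1 + B * L ^ m)) =
      ENNReal.ofReal r * ENNReal.ofReal ((m + 1 : ℕ) * δ * (1 + B * L ^ m)) := by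
    rw [← ENNReal.ofReal_natCast, ← ENNReal.ofReal_mul (by positivity),
      ← ENNReal.ofReal_mul (by positivity), ← ENNReal.ofReal_mul (by positivity)]
    congr 1
    ring
  rw [h2] at h1
  exact (ENNReal.mul_le_mul_iff_right (by simpa using hr) (by simp)).1 h1

/-- Few separated points of a semi-algebraic set of thin slices lie on translates of the moment
curve. -/
theorem exists_card_edgeSet_le (m : ℕ) : ∃ a : ℝ, 0 < a ∧ ∃ Q C : ℕ, ∀ y : ℝ, 0 < y → y ≤ 1 →
    ∀ B L : ℕ, 1 ≤ B → 1 ≤ L → B * y ≤ 1 → L * y ≤ 1 → ∀ c : Fin (m + 1) → ℝ, (∀ i, y ≤ c i) →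
    ∀ S : Bool → Set (Fin (m + 1) → ℝ), (∀ b, SignClosed (m + 1) B (S b)) →
    (∀ b, ∀ x ∈ S b, ∀ i, x i ∈ Set.Icc (0 : ℝ) L) →
    (∀ b, volume (S b) ≤ ENNReal.ofReal (a * y ^ Q)) →
    ∀ T : Finset (Fin (m + 2) → ℝ), (∀ x ∈ T, x ∈ edgeSet c L (S false) (S true)) →
    (∀ x ∈ T, ∀ x' ∈ T, x ≠ x' → ∃ i, 1 ≤ |x i - x' i|) → T.card ≤ C * L ^ m * B ^ C := by
  obtain ⟨a, ha, Q, hQ⟩ := exists_walk_parameters m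
  obtain ⟨C, hC⟩ := card_le_of_volume_projections m
  refine ⟨a, ha, Q, C * (m + 5) ^ C, fun y hy hy1 B L hB hL hBy hLy c hc S hS hbox hvol T hT
    hsep => ?_⟩
  have hr : 0 < a * y ^ Q := by positivity
  have hL' : (1 : ℝ) ≤ L := by exact_mod_cast hL
  obtain ⟨θ, δ, hθ, hθ1, hδ0, h1, h2, h3⟩ := hQ y B L (a * y ^ Q) hy hy1 (Nat.cast_nonneg B) hBy
    hL' hLy hr le_rfl
  have hdeg := (signClosed_edgeSet c (L : ℝ) (hS false) (hS true)).mono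
    (B' := (m + 5) * B) (by nlinarith)
  have key := hC ((m + 5) * B) L (by nlinarith) hL _ hdeg (fun x hx i => by
      refine Fin.cases hx.1 (fun j => hbox false _ hx.2.1 j) i) (fun k => by
      have hcast : (((m + 2) * (L + 2) ^ (m + 1) : ℕ) : ENNReal) =
          ENNReal.ofReal ((m + 2) * (L + 2) ^ (m + 1)) := by
        rw [← ENNReal.ofReal_natCast]
        push_cast
        rfl
      rw [hcast]
      refine Fin.cases ?_ (fun i => ?_) k
      · have hsub : (fun x : Fin (m + 2) → ℝ => fun j => x ((0 : Fin (m + 2)).succAbove j)) ''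
            edgeSet c L (S false) (S true) ⊆ S false := by
          rintro _ ⟨x, hx, rfl⟩
          exact hx.2.1
        calc _ ≤ _ * ENNReal.ofReal (a * y ^ Q) := by
              gcongr
              exact (measure_mono hsub).trans (hvol false)
          _ < 1 := by
              rw [← ENNReal.ofReal_mul (by positivity), ENNReal.ofReal_lt_one]
              exact h3
      · refine (mul_le_mul_right (volume_projection_edgeSet_le c hy hc hθ hθ1 hr
          (by positivity) hδ0 h1 hS hbox hvol i) _).trans_lt ?_
        rw [← ENNReal.ofReal_mul (by positivity), ENNReal.ofReal_lt_one]
        exact h2) T hT hsep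
  refine key.trans ?_
  have hCC : C ≤ C * (m + 5) ^ C := Nat.le_mul_of_pos_right _ (by positivity)
  calc C * L ^ m * ((m + 5) * B) ^ C = C * (m + 5) ^ C * L ^ m * B ^ C := by
        rw [mul_pow]
        ring
    _ ≤ _ := by gcongr

theorem IsSemialgebraic.signClosed {n : ℕ} {B : ℝ} {S : Set (Fin n → ℝ)}
    (h : IsSemialgebraic n B S) : SignClosed n ⌊B⌋₊ S := by
  obtain ⟨s, d₀, P, 𝒞, hdeg, hB, rfl⟩ := h
  refine ⟨Fin s, inferInstance, P, ?_, ?_⟩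
  · refine Nat.le_floor ?_
    refine le_trans ?_ hB
    have : ∑ l, (P l).totalDegree ≤ s * d₀ := by
      simpa using Finset.sum_le_sum fun l (_ : l ∈ Finset.univ) => hdeg l
    exact_mod_cast this
  · intro x hx y hxy
    simp only [Set.mem_iUnion] at hx ⊢
    obtain ⟨cc, hcc, hx⟩ := hx
    refine ⟨cc, hcc, fun l hl => ⟨fun h0 => (hxy l).2 ((hx l hl).1 h0), fun h1 => ?_,
      fun h2 => (hxy l).1 ((hx l hl).2.2 h2)⟩⟩
    have := (hx l hl).2.1 h1
    exact le_antisymm ((hxy l).2 this.le) ((hxy l).1 this.ge)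

theorem rep_coe (r : ℝ) : rep (r : 𝕋) = Int.fract r := by
  simp [rep]

/-- The orbit of the skew shift is affine in the frequency, with binomial slopes. -/
theorem exists_skewShift_iterate_eq (d : ℕ) (x : Fin d → 𝕋) (j : ℕ) :
    ∃ c : Fin d → ℝ, (∀ i, c i ∈ Set.Ico (0 : ℝ) 1) ∧
      ∀ ω i, (skewShift d ω)^[j] x i = ((c i + (j.choose (d - i) : ℕ) * ω : ℝ) : 𝕋) := by
  have main : ∃ c : Fin d → ℝ,
      ∀ ω i, (skewShift d ω)^[j] x i = ((c i + (j.choose (d - i) : ℕ) * ω : ℝ) : 𝕋) := by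
    induction j with
    | zero =>
      refine ⟨fun i => rep (x i), fun ω i => ?_⟩
      have h0 : Nat.choose 0 (d - i) = 0 := Nat.choose_eq_zero_of_lt (by omega)
      simp only [Function.iterate_zero, id, h0, Nat.cast_zero, zero_mul, add_zero]
      exact ((AddCircle.equivIco 1 0).symm_apply_apply (x i)).symm
    | succ j ih =>
      obtain ⟨c, hc⟩ := ih
      refine ⟨fun i => if h : (i : ℕ) + 1 < d then c i + c ⟨i + 1, h⟩ else c i, fun ω i => ?_⟩
      rw [Function.iterate_succ_apply', skewShift]
      split_ifs with h
      · rw [hc, hc, ← AddCircle.coe_add]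
        congr 1
        have h1 : d - i = (d - (i + 1)) + 1 := by omega
        simp only [h, dite_true, h1, Nat.choose_succ_succ j, Nat.succ_eq_add_one]
        push_cast
        ring
      · rw [hc, ← AddCircle.coe_add]
        congr 1
        have h1 : d - i = 1 := by omega
        simp only [h, dite_false, h1, Nat.choose_one_right]
        push_cast
        ring
  obtain ⟨c, hc⟩ := main
  refine ⟨fun i => Int.fract (c i), fun i => ⟨Int.fract_nonneg _, Int.fract_lt_one _⟩,
    fun ω i => ?_⟩
  rw [hc, AddCircle.coe_add, AddCircle.coe_add, AddCircle.coe_fract]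

/-- A linear change of coordinates turns binomial directions into monomial directions. -/
theorem exists_matrix_mulVec_pow_eq_choose (d : ℕ) :
    ∃ A : Matrix (Fin (d + 1)) (Fin (d + 1)) ℝ, A.det ≠ 0 ∧
      ∀ j : ℕ, A.mulVec (fun b => (j : ℝ) ^ (d - (b : ℕ))) =
        Fin.cons 1 fun i : Fin d => (j.choose (d - i) : ℝ) := by
  let ex : Fin (d + 1) → ℕ := Fin.cons 0 fun i : Fin d => d - i
  have hexd : ∀ a, ex a ≤ d := fun a => Fin.cases (by simp [ex]) (fun i => by simp [ex]) a
  have hinj : Function.Injective ex := by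
    intro a b
    refine Fin.cases ?_ (fun i => ?_) a <;> refine Fin.cases ?_ (fun i => ?_) b
    · simp
    · simp [ex]
      omega
    · simp [ex]
      omega
    · simp only [ex, Fin.cons_succ, Fin.succ_inj]
      intro h
      ext
      omega
  let P : ℕ → Polynomial ℝ := fun n => Polynomial.C ((n.factorial : ℝ)⁻¹) * descPochhammer ℝ n
  have hP : ∀ n j : ℕ, (P n).eval (j : ℝ) = j.choose n := by
    intro n j
    simp only [P, Polynomial.eval_mul, Polynomial.eval_C, descPochhammer_eval_eq_descFactorial]
    rw [Nat.descFactorial_eq_factorial_mul_choose]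
    push_cast
    field_simp
  have hPd : ∀ n, (P n).natDegree ≤ n := fun n => by
    refine (Polynomial.natDegree_C_mul_le _ _).trans ?_
    exact (descPochhammer_natDegree ℝ n).le
  let A : Matrix (Fin (d + 1)) (Fin (d + 1)) ℝ := Matrix.of fun a b => (P (ex a)).coeff (d - b)
  have hA : ∀ (j : ℕ) a, A.mulVec (fun b => (j : ℝ) ^ (d - (b : ℕ))) a = j.choose (ex a) := by
    intro j a
    rw [← hP, Polynomial.eval_eq_sum_range' (n := d + 1)
      (by have := (hPd (ex a)).trans (hexd a); omega)]
    rw [Finset.sum_range, ← Equiv.sum_comp Fin.revPerm]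
    simp only [Matrix.mulVec, dotProduct, A, Matrix.of_apply]
    refine Finset.sum_congr rfl fun b _ => ?_
    have : ((Fin.revPerm b : Fin (d + 1)) : ℕ) = d - b := by simp [Fin.val_rev]
    rw [this]
  refine ⟨A, ?_, fun j => funext fun a => ?_⟩
  · intro hdet
    obtain ⟨w, hw0, hw⟩ := Matrix.exists_vecMul_eq_zero_iff.2 hdet
    have hsum : ∀ j : ℕ, ∑ a, w a * (j.choose (ex a) : ℝ) = 0 := by
      intro j
      have := congrArg (fun u => u ⬝ᵥ fun b : Fin (d + 1) => (j : ℝ) ^ (d - (b : ℕ))) hw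
      simp only [zero_dotProduct, ← Matrix.dotProduct_mulVec] at this
      rw [← this]
      simp only [dotProduct, hA]
    refine hw0 (funext fun a => ?_)
    have : ∀ n, ∀ a, ex a = n → w a = 0 := by
      intro n
      induction n using Nat.strong_induction_on with
      | _ n ih =>
        intro a ha
        have := hsum n
        rw [Finset.sum_eq_single a] at this
        · simpa [ha] using this
        · intro b _ hb
          rcases lt_or_ge (ex b) n with h | h
          · rw [ih _ h b rfl, zero_mul]
          · have hne : ex b ≠ n := fun h' => hb (hinj (h'.trans ha.symm))
            rw [Nat.choose_eq_zero_of_lt (by omega)]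
            simp
        · simp
    exact this _ a rfl
  · rw [hA]
    refine Fin.cases ?_ (fun i => ?_) a <;> simp [ex]

/-- Sets covering each point of a set `Y` at most `N` times have total measure at most
`N * μ Y`. -/
theorem sum_measure_le_of_card_le {α ι : Type*} [MeasurableSpace α] (μ : Measure α) (J : Finset ι)
    (G : ι → Set α) (hG : ∀ t ∈ J, MeasurableSet (G t)) {Y : Set α} (hY : MeasurableSet Y) (N : ℕ)
    (hGY : ∀ t ∈ J, G t ⊆ Y)
    (hN : ∀ v, ∀ T : Finset ι, T ⊆ J → (∀ t ∈ T, v ∈ G t) → T.card ≤ N) :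
    ∑ t ∈ J, μ (G t) ≤ N * μ Y := by
  classical
  calc ∑ t ∈ J, μ (G t) = ∑ t ∈ J, ∫⁻ v, (G t).indicator 1 v ∂μ :=
        Finset.sum_congr rfl fun t ht => (lintegral_indicator_one (hG t ht)).symm
    _ = ∫⁻ v, ∑ t ∈ J, (G t).indicator 1 v ∂μ :=
        (lintegral_finsetSum' J fun t ht =>
          (measurable_one.indicator (hG t ht)).aemeasurable).symm
    _ ≤ ∫⁻ v, Y.indicator (fun _ => (N : ENNReal)) v ∂μ := by
        refine lintegral_mono fun v => ?_
        by_cases hv : v ∈ Y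
        · rw [Set.indicator_of_mem hv]
          calc ∑ t ∈ J, (G t).indicator 1 v = ((J.filter fun t => v ∈ G t).card : ENNReal) := by
                rw [Finset.card_filter]
                push_cast
                refine Finset.sum_congr rfl fun t _ => ?_
                simp [Set.indicator_apply]
            _ ≤ N := by
                exact_mod_cast hN v _ (Finset.filter_subset _ _)
                  fun t ht => (Finset.mem_filter.1 ht).2
        · refine (Finset.sum_eq_zero fun t ht => ?_).trans_le zero_le
          exact Set.indicator_of_notMem (fun h => hv (hGY t ht h)) _
    _ = N * μ Y := lintegral_indicator_const hY _

theorem sum_volume_line_le {n B : ℕ} {X : Set (Fin (n + 1) → ℝ)} (hX : SignClosed (n + 1) B X)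
    {R : ℝ} (hR : ∀ x ∈ X, |x 0| ≤ R) {ι : Type*} (J : Finset ι) (q u : ι → Fin (n + 1) → ℝ)
    (hq : ∀ t ∈ J, q t 0 = 0) (hu : ∀ t ∈ J, u t 0 = 1) {h r : ℝ} (hh : 0 ≤ h) (hr : 0 < r) (N : ℕ)
    (hN : ∀ v : ℝ, volume {p : Fin n → ℝ | (Fin.cons v p : Fin (n + 1) → ℝ) ∈ X} ≤
        ENNReal.ofReal r →
      volume {p : Fin n → ℝ | (Fin.cons (v + h) p : Fin (n + 1) → ℝ) ∈ X} ≤ ENNReal.ofReal r →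
      ∀ T : Finset ι, T ⊆ J → (∀ t ∈ T, q t + v • u t ∈ X ∧ q t + (v + h) • u t ∈ X) →
        T.card ≤ N) :
    ∑ t ∈ J, volume {v : ℝ | q t + v • u t ∈ X} ≤
      J.card * (ENNReal.ofReal (B * h) + 2 * (volume X / ENNReal.ofReal r)) +
        N * ENNReal.ofReal (2 * R) := by
  set f : ℝ → ENNReal := fun v => volume {p : Fin n → ℝ | (Fin.cons v p : Fin (n + 1) → ℝ) ∈ X}
    with hf
  have hfm : Measurable f := by
    have h1 : Measurable fun z : ℝ × (Fin n → ℝ) => (Fin.cons z.1 z.2 : Fin (n + 1) → ℝ) :=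
      measurable_pi_lambda _ fun i => Fin.cases measurable_fst
        (fun j => (measurable_pi_apply j).comp measurable_snd) i
    exact measurable_measure_prodMk_left (h1 hX.measurableSet)
  have hthick : volume {v | ENNReal.ofReal r ≤ f v} ≤ volume X / ENNReal.ofReal r := by
    rw [volume_eq_lintegral_cons hX.measurableSet]
    exact meas_ge_le_lintegral_div hfm.aemeasurable (by simpa using hr) (by simp)
  have hthick' : volume {v | ENNReal.ofReal r ≤ f (v + h)} ≤ volume X / ENNReal.ofReal r := by
    refine le_trans (le_of_eq ?_) hthick
    exact measure_preimage_add_right volume h {v | ENNReal.ofReal r ≤ f v}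
  let G : ι → Set ℝ := fun t => {v | q t + v • u t ∈ X ∧ q t + (v + h) • u t ∈ X ∧
    f v ≤ ENNReal.ofReal r ∧ f (v + h) ≤ ENNReal.ofReal r}
  have hlm : ∀ t, MeasurableSet {v : ℝ | q t + v • u t ∈ X} := fun t =>
    (hX.isClosed.preimage (by fun_prop : Continuous fun v : ℝ => q t + v • u t)).measurableSet
  have hlm' : ∀ t, MeasurableSet {v : ℝ | q t + (v + h) • u t ∈ X} := fun t =>
    (hX.isClosed.preimage (by fun_prop : Continuous fun v : ℝ => q t + (v + h) • u t)).measurableSet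
  have hGm : ∀ t ∈ J, MeasurableSet (G t) := fun t _ =>
    (hlm t).inter ((hlm' t).inter ((measurableSet_le hfm measurable_const).inter
      (measurableSet_le (hfm.comp (measurable_add_const h)) measurable_const)))
  have hGsum := sum_measure_le_of_card_le volume J G hGm
    (measurableSet_Icc (a := -R) (b := R)) N (fun t ht v hv => by
      have := hR _ hv.1
      rw [Pi.add_apply, Pi.smul_apply, hq t ht, hu t ht] at this
      simpa [abs_le] using this) (fun v T hT hv => by
      rcases T.eq_empty_or_nonempty with rfl | ⟨t, ht⟩
      · simp
      · exact hN v (hv t ht).2.2.1 (hv t ht).2.2.2 T hT fun t ht => ⟨(hv t ht).1, (hv t ht).2.1⟩)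
  have heach : ∀ t ∈ J, volume {v : ℝ | q t + v • u t ∈ X} ≤
      (ENNReal.ofReal (B * h) + 2 * (volume X / ENNReal.ofReal r)) + volume (G t) := by
    intro t _
    have hcover : {v : ℝ | q t + v • u t ∈ X} ⊆
        ({v | q t + v • u t ∈ X ∧ q t + (v + h) • u t ∉ X} ∪
          ({v | ENNReal.ofReal r ≤ f v} ∪ {v | ENNReal.ofReal r ≤ f (v + h)})) ∪ G t := by
      intro v hv
      by_cases h1 : q t + (v + h) • u t ∈ X
      · rcases le_total (ENNReal.ofReal r) (f v) with h2 | h2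
        · exact Or.inl (Or.inr (Or.inl h2))
        rcases le_total (ENNReal.ofReal r) (f (v + h)) with h3 | h3
        · exact Or.inl (Or.inr (Or.inr h3))
        · exact Or.inr ⟨hv, h1, h2, h3⟩
      · exact Or.inl (Or.inl ⟨hv, h1⟩)
    refine (measure_mono hcover).trans ((measure_union_le _ _).trans (add_le_add ?_ le_rfl))
    refine (measure_union_le _ _).trans (add_le_add (hX.volume_enter_le _ _ hh) ?_)
    rw [two_mul]
    exact (measure_union_le _ _).trans (add_le_add hthick hthick')
  calc _ ≤ ∑ t ∈ J, ((ENNReal.ofReal (B * h) + 2 * (volume X / ENNReal.ofReal r)) +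
        volume (G t)) := Finset.sum_le_sum heach
    _ ≤ _ := by
      rw [Finset.sum_add_distrib, Finset.sum_const, nsmul_eq_mul]
      refine add_le_add le_rfl (hGsum.trans (le_of_eq ?_))
      rw [Real.volume_Icc]
      congr 2
      ring

theorem eq_of_abs_choose_mul_sub_le {d j : ℕ} (k k' : Fin d → ℤ) {Δ η : ℝ} (h0 : |Δ| ≤ η)
    (h : ∀ i : Fin d, |(j.choose (d - i) : ℝ) * Δ - (k i - k' i)| ≤ η) (hη : (j + 1) * η < 1) :
    k = k' := by
  have hη0 : 0 ≤ η := (abs_nonneg _).trans h0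
  have main : ∀ n ≤ d, |(j.choose n : ℝ) * Δ| ≤ η ∧
      ∀ i : Fin d, d - (i : ℕ) = n → k i = k' i := by
    intro n
    induction n with
    | zero => exact fun _ => ⟨by simpa using h0, fun i hi => by omega⟩
    | succ n ih =>
      intro hn
      obtain ⟨h1, -⟩ := ih (by omega)
      have hchoose : (j.choose (n + 1) : ℝ) ≤ j * j.choose n := by
        have h2 := Nat.choose_succ_right_eq j n
        have h3 : j.choose (n + 1) ≤ j * j.choose n := by
          calc j.choose (n + 1) ≤ j.choose (n + 1) * (n + 1) := Nat.le_mul_of_pos_right _ (by omega)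
            _ = j.choose n * (j - n) := h2
            _ ≤ j.choose n * j := Nat.mul_le_mul_left _ (Nat.sub_le _ _)
            _ = _ := mul_comm _ _
        exact_mod_cast h3
      have h4 : |(j.choose (n + 1) : ℝ) * Δ| ≤ j * η := by
        calc |(j.choose (n + 1) : ℝ) * Δ| = j.choose (n + 1) * |Δ| := by
              rw [abs_mul, abs_of_nonneg (Nat.cast_nonneg (α := ℝ) _)]
          _ ≤ j * j.choose n * |Δ| := by gcongr
          _ = j * |(j.choose n : ℝ) * Δ| := by
              rw [abs_mul, abs_of_nonneg (Nat.cast_nonneg (α := ℝ) (j.choose n))]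
              ring
          _ ≤ j * η := by gcongr
      have heq : ∀ i : Fin d, d - (i : ℕ) = n + 1 → k i = k' i := by
        intro i hi
        have h5 := h i
        rw [hi] at h5
        have h6 : |((k i - k' i : ℤ) : ℝ)| < 1 := by
          push_cast
          rw [abs_le] at h4 h5
          rw [abs_lt]
          constructor <;> nlinarith
        have h7 : |k i - k' i| < 1 := by exact_mod_cast h6
        rw [Int.abs_lt_one_iff] at h7
        linarith
      refine ⟨?_, heq⟩
      have h8 := h ⟨d - (n + 1), by omega⟩
      have h9 : d - (d - (n + 1)) = n + 1 := by omega
      rw [heq ⟨d - (n + 1), by omega⟩ h9] at h8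
      simpa [h9] using h8
  funext i
  exact (main (d - i) (by omega)).2 i rfl

theorem volume_preimage_smul_sub {n : ℕ} {κ : ℝ} (hκ : 0 < κ) (w : Fin n → ℝ)
    (Y : Set (Fin n → ℝ)) :
    volume {p : Fin n → ℝ | κ⁻¹ • p - w ∈ Y} = ENNReal.ofReal (κ ^ n) * volume Y := by
  have h1 := Measure.addHaar_preimage_smul (volume : Measure (Fin n → ℝ))
    (inv_ne_zero hκ.ne') ((fun p => p - w) ⁻¹' Y)
  have h2 : volume ((fun p => p - w) ⁻¹' Y) = volume Y := by
    simpa only [sub_eq_add_neg] using measure_preimage_add_right volume (-w) Y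
  rw [h2] at h1
  refine h1.trans ?_
  rw [abs_of_pos (by positivity)]
  simp

/-- The counting bound for a family of lines through two thin slices of a semi-algebraic set. -/
theorem exists_card_lines_le (m : ℕ) : ∃ a : ℝ, 0 < a ∧ ∃ Q C : ℕ, ∀ y : ℝ, 0 < y → y ≤ 1 →
    ∀ B L : ℕ, 1 ≤ B → 1 ≤ L → B * y ≤ 1 → L * y ≤ 1 → ∀ κ ρ h R : ℝ, 0 < κ → 0 < ρ →
    (∀ i : Fin (m + 1), y ≤ κ * h / ρ ^ ((i : ℕ) + 1)) → 2 * R * κ ≤ L →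
    ∀ X : Set (Fin (m + 2) → ℝ), SignClosed (m + 2) B X → (∀ x ∈ X, ∀ i, |x i| ≤ R) → ∀ v : ℝ,
    (∀ w, w = v ∨ w = v + h → ENNReal.ofReal (κ ^ (m + 1)) *
      volume {p : Fin (m + 1) → ℝ | (Fin.cons w p : Fin (m + 2) → ℝ) ∈ X} ≤
        ENNReal.ofReal (a * y ^ Q)) →
    ∀ (ι : Type) (T : Finset ι) (q : ι → Fin (m + 2) → ℝ) (s : ι → ℝ), (∀ t ∈ T, q t 0 = 0) →
    (∀ t ∈ T, 0 ≤ s t ∧ ρ * s t ≤ L) →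
    (∀ t ∈ T, (q t + v • fun b : Fin (m + 2) => s t ^ (b : ℕ)) ∈ X ∧
      (q t + (v + h) • fun b : Fin (m + 2) => s t ^ (b : ℕ)) ∈ X) →
    (∀ t ∈ T, ∀ t' ∈ T, t ≠ t' → 1 ≤ ρ * |s t - s t'| ∨
      ∃ i, 1 ≤ κ * |(q t + v • fun b : Fin (m + 2) => s t ^ (b : ℕ)) i -
        (q t' + v • fun b : Fin (m + 2) => s t' ^ (b : ℕ)) i|) →
    T.card ≤ C * L ^ m * B ^ C := by
  classical
  obtain ⟨a, ha, Q, C, hmain⟩ := exists_card_edgeSet_le m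
  refine ⟨a, ha, Q, C, fun y hy hy1 B L hB hL hBy hLy κ ρ h R hκ hρ hc hLR X hX hXR v hthin ι T q s
    hq hs hT hsep => ?_⟩
  let z : ι → Fin (m + 2) → ℝ := fun t => q t + v • fun b : Fin (m + 2) => s t ^ (b : ℕ)
  let W : Bool → ℝ := fun b => if b then v + h else v
  let S : Bool → Set (Fin (m + 1) → ℝ) := fun b =>
    {p | (Fin.cons (W b) (κ⁻¹ • p - fun _ => R) : Fin (m + 2) → ℝ) ∈ X}
  have hSc : ∀ b, SignClosed (m + 1) B (S b) := by
    intro b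
    have h1 := ((hX.slice 0 (W b)).preimage (m := m + 1) (e := 1)
      (fun i => MvPolynomial.C κ⁻¹ * MvPolynomial.X i - MvPolynomial.C R) (fun i => by
        refine (MvPolynomial.totalDegree_sub _ _).trans (max_le ?_ (by simp))
        refine (MvPolynomial.totalDegree_mul _ _).trans ?_
        simp)).mono (B' := B) (by omega)
    refine (show S b = _ from ?_) ▸ h1
    ext p
    simp only [Set.mem_ofPred_eq, S, Fin.insertNth_zero', map_sub, map_mul, MvPolynomial.eval_C,
      MvPolynomial.eval_X]
    rfl
  have hSbox : ∀ b, ∀ p ∈ S b, ∀ i, p i ∈ Set.Icc (0 : ℝ) L := by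
    intro b p hp i
    have h1 := hXR _ hp i.succ
    simp only [Fin.cons_succ, Pi.sub_apply, Pi.smul_apply, smul_eq_mul, abs_le] at h1
    have h2 : κ⁻¹ * p i * κ = p i := by field_simp
    constructor <;> nlinarith
  have hSvol : ∀ b, volume (S b) ≤ ENNReal.ofReal (a * y ^ Q) := by
    intro b
    have h1 := volume_preimage_smul_sub hκ (fun _ : Fin (m + 1) => R)
      {p : Fin (m + 1) → ℝ | (Fin.cons (W b) p : Fin (m + 2) → ℝ) ∈ X}
    refine (le_of_eq h1).trans (hthin _ ?_)
    cases b <;> simp [W]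
  let c : Fin (m + 1) → ℝ := fun i => κ * h / ρ ^ ((i : ℕ) + 1)
  let pt : ι → Fin (m + 2) → ℝ := fun t =>
    Fin.cons (ρ * s t) (κ • (Fin.tail (z t) + fun _ => R))
  have hz0 : ∀ t ∈ T, z t 0 = v := fun t ht => by simp [z, hq t ht]
  have hmem : ∀ t ∈ T, pt t ∈ edgeSet c L (S false) (S true) := by
    intro t ht
    refine ⟨⟨mul_nonneg hρ.le (hs t ht).1, (hs t ht).2⟩, ?_, ?_⟩
    · have h1 : (Fin.cons v (κ⁻¹ • Fin.tail (pt t) - fun _ => R) : Fin (m + 2) → ℝ) = z t := by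
        ext i
        refine Fin.cases (by simp [hz0 t ht]) (fun i => ?_) i
        simp [pt, Fin.tail_def]
        field_simp
        ring
      change (Fin.cons v (κ⁻¹ • Fin.tail (pt t) - fun _ => R) : Fin (m + 2) → ℝ) ∈ X
      rw [h1]
      exact (hT t ht).1
    · have h1 : (Fin.cons (v + h) (κ⁻¹ • (Fin.tail (pt t) + momentCurve c (pt t 0)) - fun _ => R) :
          Fin (m + 2) → ℝ) = q t + (v + h) • fun b : Fin (m + 2) => s t ^ (b : ℕ) := by
        ext i
        refine Fin.cases (by simp [hq t ht]) (fun i => ?_) i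
        simp only [pt, Fin.tail_def, momentCurve, c, z, Fin.cons_succ, Fin.cons_zero, Pi.add_apply,
          Pi.smul_apply, Pi.sub_apply, smul_eq_mul, Fin.val_succ, mul_pow]
        field_simp
        ring
      change (Fin.cons (v + h) (κ⁻¹ • (Fin.tail (pt t) + momentCurve c (pt t 0)) - fun _ => R) :
          Fin (m + 2) → ℝ) ∈ X
      rw [h1]
      exact (hT t ht).2
  have hptsep : ∀ t ∈ T, ∀ t' ∈ T, t ≠ t' → ∃ i, 1 ≤ |pt t i - pt t' i| := by
    intro t ht t' ht' hne
    rcases hsep t ht t' ht' hne with h1 | ⟨i, h1⟩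
    · refine ⟨0, h1.trans (le_of_eq ?_)⟩
      simp only [pt, Fin.cons_zero]
      rw [← mul_sub, abs_mul, abs_of_pos hρ]
    · change 1 ≤ κ * |z t i - z t' i| at h1
      revert h1
      refine Fin.cases (fun h1 => ?_) (fun i h1 => ⟨i.succ, h1.trans (le_of_eq ?_)⟩) i
      · rw [hz0 t ht, hz0 t' ht'] at h1
        norm_num at h1
      · simp only [pt, Fin.cons_succ, Pi.smul_apply, Pi.add_apply, smul_eq_mul, Fin.tail_def]
        rw [← mul_sub, abs_mul, abs_of_pos hκ]
        congr 2
        ring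
  have hinj : Set.InjOn pt T := by
    intro t ht t' ht' heq
    by_contra hne
    obtain ⟨i, hi⟩ := hptsep t ht t' ht' hne
    rw [heq, sub_self, abs_zero] at hi
    linarith
  rw [← Finset.card_image_of_injOn hinj]
  refine hmain y hy hy1 B L hB hL hBy hLy c hc S hSc hSbox hSvol _ ?_ ?_
  · intro x hx
    obtain ⟨t, ht, rfl⟩ := Finset.mem_image.1 hx
    exact hmem t ht
  · intro x hx x' hx' hne
    obtain ⟨t, ht, rfl⟩ := Finset.mem_image.1 hx
    obtain ⟨t', ht', rfl⟩ := Finset.mem_image.1 hx'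
    exact hptsep t ht t' ht' fun h => hne (by rw [h])

theorem Matrix.exists_abs_mulVec_le {n : ℕ} (A : Matrix (Fin n) (Fin n) ℝ) :
    ∃ K : ℕ, 1 ≤ K ∧ ∀ (z : Fin n → ℝ) (η : ℝ), (∀ i, |z i| ≤ η) →
      ∀ a, |A.mulVec z a| ≤ K * η := by
  refine ⟨⌈∑ a, ∑ b, |A a b|⌉₊ + 1, by omega, fun z η hz a => ?_⟩
  have hη : 0 ≤ η := (abs_nonneg _).trans (hz a)
  calc |A.mulVec z a| = |∑ b, A a b * z b| := rfl
    _ ≤ ∑ b, |A a b * z b| := Finset.abs_sum_le_sum_abs _ _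
    _ ≤ ∑ b, |A a b| * η := Finset.sum_le_sum fun b _ => by
        rw [abs_mul]
        exact mul_le_mul_of_nonneg_left (hz b) (abs_nonneg _)
    _ = (∑ b, |A a b|) * η := by rw [Finset.sum_mul]
    _ ≤ (∑ a, ∑ b, |A a b|) * η := by
        refine mul_le_mul_of_nonneg_right ?_ hη
        exact Finset.single_le_sum (f := fun a => ∑ b, |A a b|)
          (fun a _ => Finset.sum_nonneg fun b _ => abs_nonneg _) (Finset.mem_univ a)
    _ ≤ _ := by
        refine mul_le_mul_of_nonneg_right ?_ hη
        push_cast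
        linarith [Nat.le_ceil (∑ a, ∑ b, |A a b|)]

theorem volume_preimage_mulVec {n : ℕ} (A : Matrix (Fin n) (Fin n) ℝ) (hA : A.det ≠ 0)
    (S : Set (Fin n → ℝ)) :
    volume {z | A.mulVec z ∈ S} = ENNReal.ofReal |A.det|⁻¹ * volume S := by
  have h := Measure.addHaar_preimage_linearMap (volume : Measure (Fin n → ℝ))
    (f := A.toLin') (by rwa [LinearMap.det_toLin']) S
  rw [LinearMap.det_toLin', abs_inv] at h
  exact h

theorem SignClosed.preimage_mulVec {n B : ℕ} {S : Set (Fin n → ℝ)} (hS : SignClosed n B S)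
    (A : Matrix (Fin n) (Fin n) ℝ) : SignClosed n B {z | A.mulVec z ∈ S} := by
  have h1 := (hS.preimage (m := n) (e := 1)
      (fun a => ∑ b, MvPolynomial.C (A a b) * MvPolynomial.X b) (fun a => by
        refine MvPolynomial.totalDegree_finsetSum_le fun b _ => ?_
        refine (MvPolynomial.totalDegree_mul _ _).trans ?_
        simp)).mono (B' := B) (by omega)
  convert h1 using 3
  simp only [map_sum, map_mul, MvPolynomial.eval_C, MvPolynomial.eval_X]
  rfl

theorem volume_preimage_affine_le {b p P : ℝ} (hP : 0 < P) (hp : P ≤ p) (V : Set ℝ) :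
    volume {ω : ℝ | b + ω * p ∈ V} ≤ ENNReal.ofReal P⁻¹ * volume V := by
  have hp0 : 0 < p := hP.trans_le hp
  have h1 := Real.volume_preimage_mul_right hp0.ne' ((fun v => b + v) ⁻¹' V)
  have h2 : volume ((fun v => b + v) ⁻¹' V) = volume V := measure_preimage_add volume b V
  rw [h2] at h1
  refine (le_of_eq h1).trans ?_
  gcongr
  rw [abs_of_pos (by positivity)]
  gcongr

theorem exists_nat_lt_of_cons_rep_mem {d : ℕ} {S : Set (Fin (d + 1) → ℝ)} {c : Fin d → ℝ} {ω : ℝ}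
    {M j : ℕ} (hM : 1 ≤ M) (hj : j ≤ 2 * M) (hω : ω ∈ Set.Icc (0 : ℝ) 1)
    (hc : ∀ i, c i ∈ Set.Ico (0 : ℝ) 1)
    (hx : (Fin.cons ω fun i => Int.fract (c i + (j.choose (d - i) : ℕ) * ω) : Fin (d + 1) → ℝ) ∈
      S) :
    ∃ k : Fin d → ℕ, (∀ i, k i < (2 * M) ^ d + 2) ∧
      (Fin.cons ω fun i => c i + (j.choose (d - i) : ℕ) * ω - k i : Fin (d + 1) → ℝ) ∈ S := by
  have h0 : ∀ i : Fin d, 0 ≤ c i + (j.choose (d - i) : ℕ) * ω := fun i =>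
    add_nonneg (hc i).1 (mul_nonneg (Nat.cast_nonneg _) hω.1)
  refine ⟨fun i => ⌊c i + (j.choose (d - i) : ℕ) * ω⌋₊, fun i => ?_, ?_⟩
  · rw [Nat.floor_lt (h0 i)]
    have h1 : j.choose (d - i) ≤ (2 * M) ^ d := calc
      j.choose (d - i) ≤ j ^ (d - (i : ℕ)) := Nat.choose_le_pow _ _
      _ ≤ (2 * M) ^ (d - (i : ℕ)) := Nat.pow_le_pow_left hj _
      _ ≤ (2 * M) ^ d := Nat.pow_le_pow_right (by omega) (Nat.sub_le _ _)
    have h2 : (j.choose (d - i) : ℝ) ≤ ((2 * M) ^ d : ℕ) := by exact_mod_cast h1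
    push_cast at h2 ⊢
    have h3 := (hc i).2
    have h4 : (j.choose (d - i) : ℝ) * ω ≤ j.choose (d - i) * 1 :=
      mul_le_mul_of_nonneg_left hω.2 (Nat.cast_nonneg _)
    linarith
  · convert hx using 3 with i
    rw [natCast_floor_eq_intCast_floor (h0 i), Int.self_sub_floor]

theorem one_le_mul_abs_inv_sub_inv {M j j' : ℕ} (hM : 1 ≤ M) (hj : j ∈ Finset.Icc M (2 * M))
    (hj' : j' ∈ Finset.Icc M (2 * M)) (hne : j ≠ j') :
    1 ≤ (4 * M ^ 2 : ℝ) * |(j : ℝ)⁻¹ - (j' : ℝ)⁻¹| := by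
  rw [Finset.mem_Icc] at hj hj'
  have h1 : (0 : ℝ) < j := by exact_mod_cast hM.trans hj.1
  have h2 : (0 : ℝ) < j' := by exact_mod_cast hM.trans hj'.1
  have h3 : (j : ℝ) ≤ 2 * M := by exact_mod_cast hj.2
  have h4 : (j' : ℝ) ≤ 2 * M := by exact_mod_cast hj'.2
  have h5 : (1 : ℝ) ≤ |(j' : ℝ) - j| := by
    have : 1 ≤ |(j' : ℤ) - j| := Int.one_le_abs (by omega)
    exact_mod_cast this
  rw [inv_sub_inv h1.ne' h2.ne', abs_div, abs_of_pos (mul_pos h1 h2), ← mul_div_assoc,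
    le_div_iff₀ (mul_pos h1 h2)]
  nlinarith [mul_le_mul h3 h4 h2.le (by positivity)]

theorem exists_volume_frequency_le (m : ℕ) : ∃ K : ℕ, 1 ≤ K ∧ ∃ a : ℝ, 0 < a ∧ ∃ Q C : ℕ,
    ∀ M B : ℕ, 1 ≤ M → 1 ≤ B → ∀ S : Set (Fin (m + 2) → ℝ), SignClosed (m + 2) B S →
    (∀ y ∈ S, ∀ i, y i ∈ Set.Icc (0 : ℝ) 1) → ∀ h y r μ : ℝ, 0 < h → 0 < y → y ≤ 1 →
    B * y ≤ 1 → (K * M : ℕ) * y ≤ 1 → y * (4 * M ^ 2) ^ (m + 1) ≤ h → 0 < r →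
    (K * M : ℝ) ^ (m + 1) * r ≤ a * y ^ Q → volume S ≤ ENNReal.ofReal μ →
    ∀ x : Fin (m + 1) → 𝕋,
      volume {ω ∈ Set.Icc (0 : ℝ) 1 | ∃ j : ℕ, M ≤ j ∧ j ≤ 2 * M ∧
        (Fin.cons ω (fun i => rep ((skewShift (m + 1) ω)^[j] x i)) : Fin (m + 2) → ℝ) ∈ S} ≤
      ENNReal.ofReal ((M ^ (m + 1))⁻¹ : ℝ) *
        (((M + 1) * ((2 * M) ^ (m + 1) + 2) ^ (m + 1) : ℕ) *
          (ENNReal.ofReal (B * h) + 2 * (ENNReal.ofReal (K * μ) / ENNReal.ofReal r)) +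
        (K * (K * M) ^ m * B ^ C : ℕ)) := by
  classical
  obtain ⟨A, hA, hAu⟩ := exists_matrix_mulVec_pow_eq_choose (m + 1)
  obtain ⟨K₀, hK₀, hK₀A⟩ := A.exists_abs_mulVec_le
  obtain ⟨R, hR, hRA⟩ := A⁻¹.exists_abs_mulVec_le
  obtain ⟨a, ha, Q, C, hcount⟩ := exists_card_lines_le m
  have hAinv : ∀ w, A.mulVec (A⁻¹.mulVec w) = w := fun w => by
    rw [Matrix.mulVec_mulVec, Matrix.mul_nonsing_inv _ (isUnit_iff_ne_zero.2 hA), Matrix.one_mulVec]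
  have hinvA : ∀ w, A⁻¹.mulVec (A.mulVec w) = w := fun w => by
    rw [Matrix.mulVec_mulVec, Matrix.nonsing_inv_mul _ (isUnit_iff_ne_zero.2 hA), Matrix.one_mulVec]
  let K := 4 + 8 * R * K₀ + 2 * R * C + ⌈|A.det|⁻¹⌉₊
  refine ⟨K, by omega, a, ha, Q, C, fun M B hM hB S hS hbox h y r μ hh hy hy1 hBy hKy hyh hr hra hμ
    x => ?_⟩
  choose c hc hcx using exists_skewShift_iterate_eq (m + 1) x
  let X : Set (Fin (m + 2) → ℝ) := {z | A.mulVec z ∈ S}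
  have hX : SignClosed (m + 2) B X := hS.preimage_mulVec A
  have hXR : ∀ z ∈ X, ∀ i, |z i| ≤ R := by
    intro z hz i
    have h1 := hRA (A.mulVec z) 1 (fun i => by
      have := hbox _ hz i
      rw [abs_of_nonneg this.1]
      exact this.2) i
    rwa [hinvA, mul_one] at h1
  have hXvol : volume X ≤ ENNReal.ofReal (K * μ) := by
    rw [volume_preimage_mulVec A hA, ENNReal.ofReal_mul (Nat.cast_nonneg _)]
    refine mul_le_mul' (ENNReal.ofReal_le_ofReal ((Nat.le_ceil _).trans ?_)) hμ
    exact_mod_cast Nat.le_add_left _ _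
  let J : Finset (ℕ × (Fin (m + 1) → ℕ)) := Finset.Icc M (2 * M) ×ˢ
    Fintype.piFinset fun _ => Finset.range ((2 * M) ^ (m + 1) + 2)
  let u : ℕ × (Fin (m + 1) → ℕ) → Fin (m + 2) → ℝ := fun t b => (t.1 : ℝ)⁻¹ ^ (b : ℕ)
  let β : ℕ × (Fin (m + 1) → ℕ) → Fin (m + 2) → ℝ := fun t =>
    A⁻¹.mulVec (Fin.cons 0 fun i => c t.1 i - t.2 i)
  let q : ℕ × (Fin (m + 1) → ℕ) → Fin (m + 2) → ℝ := fun t => β t - β t 0 • u t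
  have hJ : ∀ t ∈ J, t.1 ∈ Finset.Icc M (2 * M) := fun t ht => (Finset.mem_product.1 ht).1
  have hJpos : ∀ t ∈ J, (0 : ℝ) < t.1 := fun t ht => by
    have := (Finset.mem_Icc.1 (hJ t ht)).1
    exact_mod_cast hM.trans this
  have hu0 : ∀ t, u t 0 = 1 := fun t => by simp [u]
  have hq0 : ∀ t, q t 0 = 0 := fun t => by simp [q, hu0]
  have hline : ∀ t ∈ J, ∀ ω : ℝ, A.mulVec (q t + (β t 0 + ω * t.1 ^ (m + 1)) • u t) =
      Fin.cons ω fun i => c t.1 i + (t.1.choose (m + 1 - i) : ℕ) * ω - t.2 i := by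
    intro t ht ω
    have h1 : q t + (β t 0 + ω * t.1 ^ (m + 1)) • u t =
        β t + ω • fun b : Fin (m + 2) => (t.1 : ℝ) ^ (m + 1 - (b : ℕ)) := by
      ext b
      simp only [q, u, Pi.add_apply, Pi.sub_apply, Pi.smul_apply, smul_eq_mul]
      rw [pow_sub₀ _ (hJpos t ht).ne' (by omega : (b : ℕ) ≤ m + 1), inv_pow]
      ring
    rw [h1, Matrix.mulVec_add, Matrix.mulVec_smul, hAu, hAinv]
    ext i
    refine Fin.cases (by simp) (fun i => ?_) i
    simp
    ring
  have hcover : {ω ∈ Set.Icc (0 : ℝ) 1 | ∃ j : ℕ, M ≤ j ∧ j ≤ 2 * M ∧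
        (Fin.cons ω (fun i => rep ((skewShift (m + 1) ω)^[j] x i)) : Fin (m + 2) → ℝ) ∈ S} ⊆
      ⋃ t ∈ J, {ω | β t 0 + ω * t.1 ^ (m + 1) ∈ {v | q t + v • u t ∈ X}} := by
    rintro ω ⟨hω, j, hMj, hj, hmem⟩
    simp only [hcx, rep_coe] at hmem
    obtain ⟨k, hk, hkS⟩ := exists_nat_lt_of_cons_rep_mem hM hj hω (hc j) hmem
    have ht : (j, k) ∈ J := by
      simp only [J, Finset.mem_product, Finset.mem_Icc, Fintype.mem_piFinset, Finset.mem_range]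
      exact ⟨⟨hMj, hj⟩, hk⟩
    refine Set.mem_biUnion ht ?_
    change A.mulVec _ ∈ S
    rw [hline _ ht]
    exact hkS
  have hN : ∀ v : ℝ, volume {p : Fin (m + 1) → ℝ | (Fin.cons v p : Fin (m + 2) → ℝ) ∈ X} ≤
        ENNReal.ofReal r →
      volume {p : Fin (m + 1) → ℝ | (Fin.cons (v + h) p : Fin (m + 2) → ℝ) ∈ X} ≤
        ENNReal.ofReal r →
      ∀ T ⊆ J, (∀ t ∈ T, q t + v • u t ∈ X ∧ q t + (v + h) • u t ∈ X) →
        T.card ≤ C * (K * M) ^ m * B ^ C := by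
    intro v hv hvh T hTJ hT
    have hκ : (0 : ℝ) < 4 * K₀ * M := by positivity
    have hκK : (4 * K₀ * M : ℝ) ≤ K * M := by
      have h1 : K₀ ≤ R * K₀ := Nat.le_mul_of_pos_left _ hR
      have : 4 * K₀ ≤ K := by
        simp only [K, mul_assoc]
        omega
      exact_mod_cast Nat.mul_le_mul_right M this
    refine hcount y hy hy1 B (K * M) hB (Nat.mul_pos (by omega) hM) hBy hKy (4 * K₀ * M) (4 * M ^ 2)
      h R hκ (by positivity) (fun i => ?_) ?_ X hX hXR v (fun w hw => ?_) _ T q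
      (fun t => (t.1 : ℝ)⁻¹) (fun t _ => hq0 t) (fun t ht => ?_) hT fun t ht t' ht' hne => ?_
    · rw [le_div_iff₀ (by positivity)]
      have h0 : (1 : ℝ) ≤ M := by exact_mod_cast hM
      have h1 : (4 * M ^ 2 : ℝ) ^ ((i : ℕ) + 1) ≤ (4 * M ^ 2) ^ (m + 1) :=
        pow_le_pow_right₀ (by nlinarith) (by omega)
      have h2 : (1 : ℝ) ≤ 4 * K₀ * M := by
        have : 1 ≤ 4 * K₀ * M := by nlinarith
        exact_mod_cast this
      nlinarith [mul_le_mul_of_nonneg_left h1 hy.le]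
    · have h1 : 2 * R * (4 * K₀ * M) ≤ K * M := by
        calc 2 * R * (4 * K₀ * M) = 8 * R * K₀ * M := by ring
          _ ≤ K * M := Nat.mul_le_mul_right M (by omega)
      exact_mod_cast h1
    · refine (mul_le_mul_right (?_ : _ ≤ ENNReal.ofReal r) _).trans ?_
      · rcases hw with rfl | rfl
        exacts [hv, hvh]
      · rw [← ENNReal.ofReal_mul (by positivity)]
        refine ENNReal.ofReal_le_ofReal (le_trans ?_ hra)
        gcongr
    · refine ⟨by positivity, ?_⟩
      have h1 : (M : ℝ) ≤ t.1 := by exact_mod_cast (Finset.mem_Icc.1 (hJ t (hTJ ht))).1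
      rw [← div_eq_mul_inv, div_le_iff₀ (hJpos t (hTJ ht))]
      have h2 : (4 : ℝ) ≤ K := by exact_mod_cast (by omega : 4 ≤ K)
      push_cast
      nlinarith [mul_le_mul h2 h1 (by positivity) (by positivity)]
    · by_cases hj : t.1 = t'.1
      · right
        by_contra! hcon
        refine hne (Prod.ext hj ?_)
        have hz : ∀ i, |((q t + v • u t) - (q t' + v • u t')) i| ≤ (4 * K₀ * M : ℝ)⁻¹ := by
          intro i
          have h1 := hcon i
          rw [inv_eq_one_div, le_div_iff₀ hκ, mul_comm]
          exact h1.le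
        have hη := hK₀A _ _ hz
        have hηM : (K₀ * (4 * K₀ * M : ℝ)⁻¹) = (4 * M : ℝ)⁻¹ := by
          field_simp
        have hv : ∀ t ∈ J, v = β t 0 + (v - β t 0) / t.1 ^ (m + 1) * t.1 ^ (m + 1) := by
          intro t ht
          have := (pow_pos (hJpos t ht) (m + 1)).ne'
          field_simp
          ring
        have hw : ∀ t ∈ J, A.mulVec (q t + v • u t) = Fin.cons ((v - β t 0) / t.1 ^ (m + 1))
            fun i => c t.1 i + (t.1.choose (m + 1 - i) : ℕ) * ((v - β t 0) / t.1 ^ (m + 1)) -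
              t.2 i := by
          intro t ht
          rw [← hline t ht, ← hv t ht]
        rw [Matrix.mulVec_sub, hw t (hTJ ht), hw t' (hTJ ht'), hηM, ← hj] at hη
        have hk := eq_of_abs_choose_mul_sub_le (j := t.1) (fun i => (t.2 i : ℤ))
          (fun i => (t'.2 i : ℤ)) (hη 0) (fun i => ?_) ?_
        · funext i
          exact_mod_cast congrFun hk i
        · refine le_trans (le_of_eq ?_) (hη i.succ)
          congr 1
          simp
          ring
        · have h1 : (t.1 : ℝ) ≤ 2 * M := by
            exact_mod_cast (Finset.mem_Icc.1 (hJ t (hTJ ht))).2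
          have h2 : (1 : ℝ) ≤ M := by exact_mod_cast hM
          rw [← div_eq_mul_inv, div_lt_one (by positivity)]
          linarith
      · exact Or.inl (one_le_mul_abs_inv_sub_inv hM (hJ t (hTJ ht)) (hJ t' (hTJ ht')) hj)
  have hsum := sum_volume_line_le hX (fun z hz => hXR z hz 0) J q u (fun t _ => hq0 t)
    (fun t _ => hu0 t) hh.le hr _ hN
  refine (measure_mono hcover).trans ((measure_biUnion_finset_le _ _).trans ?_)
  calc _ ≤ ∑ t ∈ J, ENNReal.ofReal ((M ^ (m + 1))⁻¹ : ℝ) * volume {v | q t + v • u t ∈ X} := by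
        refine Finset.sum_le_sum fun t ht => ?_
        refine volume_preimage_affine_le (by positivity) ?_ _
        have := (Finset.mem_Icc.1 (hJ t ht)).1
        gcongr
    _ ≤ _ := by
      rw [← Finset.mul_sum]
      refine mul_le_mul_right (hsum.trans ?_) _
      have hcard : J.card = (M + 1) * ((2 * M) ^ (m + 1) + 2) ^ (m + 1) := by
        simp only [J, Finset.card_product, Nat.card_Icc, Fintype.card_piFinset, Finset.card_range,
          Finset.prod_const, Finset.card_univ, Fintype.card_fin]
        congr 1
        omega
      rw [hcard]
      gcongr
      rw [← Nat.cast_ofNat (R := ℝ), ← Nat.cast_mul, ENNReal.ofReal_natCast, ← Nat.cast_mul]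
      refine Nat.cast_le.2 ?_
      have h1 : C * (2 * R) ≤ K := by
        have : 2 * R * C ≤ K := by omega
        linarith
      calc C * (K * M) ^ m * B ^ C * (2 * R) = C * (2 * R) * ((K * M) ^ m * B ^ C) := by ring
        _ ≤ K * ((K * M) ^ m * B ^ C) := Nat.mul_le_mul_right _ h1
        _ = K * (K * M) ^ m * B ^ C := by ring

theorem exists_volume_frequency_le_of_le (m : ℕ) : ∃ D P C : ℕ, ∀ M B : ℕ, D ≤ M → 1 ≤ B → B ≤ M →
    ∀ S : Set (Fin (m + 2) → ℝ), SignClosed (m + 2) B S →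
    (∀ y ∈ S, ∀ i, y i ∈ Set.Icc (0 : ℝ) 1) → volume S ≤ ENNReal.ofReal ((M : ℝ)⁻¹ ^ P) →
    ∀ x : Fin (m + 1) → 𝕋,
      volume {ω ∈ Set.Icc (0 : ℝ) 1 | ∃ j : ℕ, M ≤ j ∧ j ≤ 2 * M ∧
        (Fin.cons ω (fun i => rep ((skewShift (m + 1) ω)^[j] x i)) : Fin (m + 2) → ℝ) ∈ S} ≤
      ENNReal.ofReal (D * B ^ C * (M : ℝ)⁻¹) := by
  obtain ⟨K, hK, a, ha, Q, C, hmain⟩ := exists_volume_frequency_le m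
  let p := 2 + (2 * (m + 1) + 1) * (m + 1)
  let e := p + 1 + 4 * (m + 1)
  let f := 1 + 2 * (m + 1) + e * Q
  refine ⟨4 + K ^ (m + 1) + ⌈a⁻¹⌉₊, p + 1 + f, C, fun M B hM hB hBM S hS hbox hSvol x => ?_⟩
  have hKM : K ≤ M := (Nat.le_self_pow (by omega : m + 1 ≠ 0) K).trans (by omega)
  have hM4 : 4 ≤ M := by omega
  have hMr : (4 : ℝ) ≤ M := by exact_mod_cast hM4
  have hKMr : (K : ℝ) ≤ M := by exact_mod_cast hKM
  have hBMr : (B : ℝ) ≤ M := by exact_mod_cast hBM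
  have ha1 : a⁻¹ ≤ M := (Nat.le_ceil _).trans (by exact_mod_cast (by omega : ⌈a⁻¹⌉₊ ≤ M))
  set z : ℝ := (M : ℝ)⁻¹ with hz
  have hM0 : (0 : ℝ) < M := by linarith
  have hz0 : 0 < z := by positivity
  have hz1 : z ≤ 1 := inv_le_one_of_one_le₀ (by linarith)
  have hzM : (M : ℝ) * z = 1 := mul_inv_cancel₀ hM0.ne'
  have hza : z ≤ a := inv_le_of_inv_le₀ ha ha1
  have hpow : ∀ n k : ℕ, (M : ℝ) ^ n * z ^ (n + k) = z ^ k := fun n k => by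
    rw [pow_add, ← mul_assoc, ← mul_pow, hzM, one_pow, one_mul]
  have hmul : ∀ (A : ℝ) (n : ℕ), A ≤ M → A * z ^ (n + 1) ≤ z ^ n := fun A n hA => by
    calc A * z ^ (n + 1) ≤ M * z ^ (n + 1) := by gcongr
      _ = z ^ n := by simpa [add_comm] using hpow 1 n
  refine (hmain M B (by omega) hB S hS hbox (z ^ (p + 1)) (z ^ e) (z ^ f) (z ^ (p + 1 + f))
    (by positivity) (by positivity) (pow_le_one₀ hz0.le hz1) ?_ ?_ ?_ (by positivity) ?_ hSvol
    x).trans ?_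
  · exact (hmul B (e - 1) hBMr).trans (pow_le_one₀ hz0.le hz1)
  · have he : e = (e - 2 + 1) + 1 := by omega
    push_cast
    rw [he]
    calc (K : ℝ) * M * z ^ ((e - 2 + 1) + 1) = K * (M * z ^ ((e - 2 + 1) + 1)) := by ring
      _ ≤ K * z ^ (e - 2 + 1) := mul_le_mul_of_nonneg_left (hmul _ _ le_rfl) (Nat.cast_nonneg _)
      _ ≤ z ^ (e - 2) := hmul _ _ hKMr
      _ ≤ 1 := pow_le_one₀ hz0.le hz1
  · have h1 : (4 * M ^ 2 : ℝ) ^ (m + 1) ≤ M ^ (4 * (m + 1)) := by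
      rw [pow_mul]
      exact pow_le_pow_left₀ (by positivity) (by
        nlinarith [mul_le_mul_of_nonneg_right (by nlinarith : (4 : ℝ) ≤ M ^ 2)
          (sq_nonneg (M : ℝ))]) _
    calc z ^ e * (4 * M ^ 2 : ℝ) ^ (m + 1) ≤ z ^ e * M ^ (4 * (m + 1)) := by gcongr
      _ = M ^ (4 * (m + 1)) * z ^ (4 * (m + 1) + (p + 1)) := by
        rw [mul_comm, show e = 4 * (m + 1) + (p + 1) by omega]
      _ ≤ z ^ (p + 1) := (hpow _ _).le
  · have h1 : (K * M : ℝ) ^ (m + 1) ≤ M ^ (2 * (m + 1)) := by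
      rw [pow_mul]
      exact pow_le_pow_left₀ (by positivity) (by nlinarith) _
    calc (K * M : ℝ) ^ (m + 1) * z ^ f ≤ M ^ (2 * (m + 1)) * z ^ f := by gcongr
      _ = M ^ (2 * (m + 1)) * z ^ (2 * (m + 1) + (e * Q + 1)) := by
        rw [show f = 2 * (m + 1) + (e * Q + 1) by omega]
      _ = z * (z ^ e) ^ Q := by rw [hpow, ← pow_mul, pow_succ, mul_comm]
      _ ≤ a * (z ^ e) ^ Q := by gcongr
  · have hcard : (M + 1) * ((2 * M) ^ (m + 1) + 2) ^ (m + 1) ≤ M ^ p := by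
      have h1 : M + 1 ≤ M ^ 2 := by nlinarith
      have h2 : (2 * M) ^ (m + 1) ≤ M ^ (2 * (m + 1)) := by
        rw [pow_mul]
        exact Nat.pow_le_pow_left (by nlinarith) _
      have h3 : (2 * M) ^ (m + 1) + 2 ≤ M ^ (2 * (m + 1) + 1) := by
        have h4 : 1 ≤ M ^ (2 * (m + 1)) := Nat.one_le_pow _ _ (by omega)
        rw [pow_succ M (2 * (m + 1))]
        nlinarith
      calc (M + 1) * ((2 * M) ^ (m + 1) + 2) ^ (m + 1) ≤
          M ^ 2 * (M ^ (2 * (m + 1) + 1)) ^ (m + 1) := by gcongr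
        _ = M ^ p := by rw [← pow_mul, ← pow_add]
    have hin : ENNReal.ofReal (B * z ^ (p + 1)) + 2 * (ENNReal.ofReal (K * z ^ (p + 1 + f)) /
        ENNReal.ofReal (z ^ f)) ≤ ENNReal.ofReal (3 * z ^ p) := by
      rw [← ENNReal.ofReal_div_of_pos (by positivity), ← ENNReal.ofReal_ofNat 2,
        ← ENNReal.ofReal_mul (by positivity), ← ENNReal.ofReal_add (by positivity) (by positivity)]
      refine ENNReal.ofReal_le_ofReal ?_
      have h1 : K * z ^ (p + 1 + f) / z ^ f = K * z ^ (p + 1) := by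
        rw [pow_add z (p + 1) f]
        field_simp
      rw [h1]
      linarith [hmul _ p hBMr, hmul _ p hKMr]
    have hfirst : (((M + 1) * ((2 * M) ^ (m + 1) + 2) ^ (m + 1) : ℕ) : ENNReal) *
        (ENNReal.ofReal (B * z ^ (p + 1)) + 2 * (ENNReal.ofReal (K * z ^ (p + 1 + f)) /
        ENNReal.ofReal (z ^ f))) ≤ ENNReal.ofReal 3 := by
      refine (mul_le_mul' (Nat.cast_le.2 hcard) hin).trans (le_of_eq ?_)
      rw [← ENNReal.ofReal_natCast, ← ENNReal.ofReal_mul (Nat.cast_nonneg _)]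
      congr 1
      push_cast
      have h1 := hpow p 0
      rw [add_zero, pow_zero] at h1
      linarith
    refine (mul_le_mul_right (add_le_add_left hfirst _) _).trans ?_
    rw [← ENNReal.ofReal_natCast (K * (K * M) ^ m * B ^ C), ← ENNReal.ofReal_add (by norm_num)
      (Nat.cast_nonneg _), ← ENNReal.ofReal_mul (by positivity)]
    refine ENNReal.ofReal_le_ofReal ?_
    have hBC : (1 : ℝ) ≤ B ^ C := one_le_pow₀ (by exact_mod_cast hB)
    rw [← inv_pow, ← hz]
    push_cast
    have h1 : z ^ (m + 1) ≤ z := by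
      simpa using pow_le_pow_of_le_one hz0.le hz1 (by omega : 1 ≤ m + 1)
    have h2 : z ^ (m + 1) * (K * (K * M) ^ m * B ^ C : ℝ) = K ^ (m + 1) * B ^ C * z := by
      calc z ^ (m + 1) * (K * (K * M) ^ m * B ^ C : ℝ) =
          K ^ (m + 1) * B ^ C * (M ^ m * z ^ (m + 1)) := by ring
        _ = _ := by rw [hpow m 1, pow_one]
    have h3 : (0 : ℝ) ≤ ⌈a⁻¹⌉₊ * (B ^ C * z) := by positivity
    have h4 : z ≤ B ^ C * z := by nlinarith
    rw [mul_add, h2]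
    nlinarith

/-- If `n ≥ 3`, `B ^ n ≤ M` and `log M ≤ B ^ (σ / n)` with `B ≥ 2`, then `e ^ (-B ^ σ)` is at most
`M ^ (-P)` for every `P ≤ n`. -/
theorem exp_neg_rpow_le_inv_pow {B σ : ℝ} {M n P : ℕ} (hB : 2 ≤ B) (hn : 3 ≤ n) (hP : P ≤ n)
    (hBM : B ^ n ≤ M) (hlog : Real.log M ≤ B ^ (σ / n)) :
    Real.exp (-(B ^ σ)) ≤ (M : ℝ)⁻¹ ^ P := by
  have hM : (2 : ℝ) ^ n ≤ M := (pow_le_pow_left₀ (by norm_num) hB n).trans hBM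
  have hM0 : (0 : ℝ) < M := lt_of_lt_of_le (by positivity) hM
  have hn0 : (n : ℝ) ≠ 0 := by
    have : n ≠ 0 := by omega
    exact_mod_cast this
  have hlog2 : 2 ≤ Real.log M := by
    have h1 : n * Real.log 2 ≤ Real.log M := by
      rw [← Real.log_pow]
      exact Real.log_le_log (by positivity) hM
    have h2 : (3 : ℝ) ≤ n := by exact_mod_cast hn
    nlinarith [Real.log_two_gt_d9]
  have hpow : Real.log M ^ n ≤ B ^ σ := by
    refine (pow_le_pow_left₀ (by linarith) hlog n).trans (le_of_eq ?_)
    rw [← Real.rpow_natCast, ← Real.rpow_mul (by linarith), div_mul_cancel₀ _ hn0]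
  have hPlog : P * Real.log M ≤ B ^ σ := by
    refine le_trans ?_ hpow
    have h1 : (P : ℝ) ≤ Real.log M ^ (n - 1) := by
      have h2 : n ≤ 2 ^ (n - 1) := by
        have := Nat.lt_two_pow_self (n := n - 1)
        omega
      calc (P : ℝ) ≤ (2 : ℝ) ^ (n - 1) := by exact_mod_cast hP.trans h2
        _ ≤ _ := pow_le_pow_left₀ (by norm_num) hlog2 _
    calc P * Real.log M ≤ Real.log M ^ (n - 1) * Real.log M := by gcongr
      _ = Real.log M ^ n := by
        rw [← pow_succ]
        congr 1
        omega
  calc Real.exp (-(B ^ σ)) ≤ Real.exp (-(P * Real.log M)) := by gcongr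
    _ = _ := by
      rw [Real.exp_neg, ← Real.log_pow, Real.exp_log (by positivity), inv_pow]

/-- elimination of the frequency `ω` (Lemma 4.6): for a semi-algebraic
`S ⊆ [0,1]^{d+1}` of degree `≤ B` and measure `< e^{-B^σ}`, and `M` with
`B ≤ M^{1/C}`, `log M ≤ B^{σ/C}`, the set of `ω ∈ [0,1]` for which `(ω, T_ω^j x) ∈ S` for some
`M ≤ j ≤ 2M` has measure `< M^{-c}`. -/
theorem statement_15 (d : ℕ) (hd : 2 ≤ d) (σ : ℝ) (hσ : 0 < σ) :
    ∃ c C : ℝ, 0 < c ∧ 0 < C ∧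
      ∀ B : ℝ, 2 ≤ B →
      ∀ S : Set (Fin (d + 1) → ℝ), IsSemialgebraic (d + 1) B S →
        (∀ y ∈ S, ∀ i, y i ∈ Set.Icc (0 : ℝ) 1) →
        volume S < ENNReal.ofReal (Real.exp (-(B ^ σ))) →
      ∀ M : ℕ, B ≤ (M : ℝ) ^ (1 / C) → Real.log M ≤ B ^ (σ / C) →
      ∀ x : Fin d → 𝕋,
        volume {ω ∈ Set.Icc (0 : ℝ) 1 |
            ∃ j : ℕ, M ≤ j ∧ j ≤ 2 * M ∧
              (Fin.cons ω (fun i => rep ((skewShift d ω)^[j] x i)) : Fin (d + 1) → ℝ) ∈ S}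
          < ENNReal.ofReal ((M : ℝ) ^ (-c)) := by
  obtain ⟨m, rfl⟩ : ∃ m, d = m + 1 := ⟨d - 1, by omega⟩
  obtain ⟨D, P, C, hmain⟩ := exists_volume_frequency_le_of_le m
  let n := 3 + P + 2 * (D + C + 1)
  refine ⟨1 / 2, n, by norm_num, by positivity, fun B hB S hS hbox hvol M hBM hlog x => ?_⟩
  have hBn : B ^ n ≤ M := by
    have h1 := pow_le_pow_left₀ (by linarith) hBM n
    rwa [one_div, Real.rpow_inv_natCast_pow (Nat.cast_nonneg _) (by omega)] at h1
  have hM1 : (1 : ℝ) ≤ M := (one_le_pow₀ (by linarith)).trans hBn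
  have hDB : (D : ℝ) < B ^ D := calc
    (D : ℝ) < (2 : ℝ) ^ D := by exact_mod_cast Nat.lt_two_pow_self
    _ ≤ B ^ D := pow_le_pow_left₀ (by norm_num) hB D
  have hpowM : ∀ k ≤ n, B ^ k ≤ M := fun k hk => (pow_le_pow_right₀ (by linarith) hk).trans hBn
  have hDM : D ≤ M := by exact_mod_cast hDB.le.trans (hpowM D (by omega))
  have hfloor : (⌊B⌋₊ : ℝ) ≤ B := Nat.floor_le (by linarith)
  have hBfM : ⌊B⌋₊ ≤ M := by
    have h1 : (⌊B⌋₊ : ℝ) ≤ M := hfloor.trans (by simpa using hpowM 1 (by omega))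
    exact_mod_cast h1
  refine (hmain M ⌊B⌋₊ hDM (Nat.le_floor (by norm_num; linarith)) hBfM S hS.signClosed hbox
    (hvol.le.trans (ENNReal.ofReal_le_ofReal
      (exp_neg_rpow_le_inv_pow hB (by omega) (by omega) hBn hlog))) x).trans_lt ?_
  rw [ENNReal.ofReal_lt_ofReal_iff (by positivity)]
  have hsq : (B ^ (D + C + 1)) ^ 2 ≤ M := by
    rw [← pow_mul]
    exact hpowM _ (by omega)
  have hlt : D * (⌊B⌋₊ : ℝ) ^ C < Real.sqrt M := calc
    D * (⌊B⌋₊ : ℝ) ^ C ≤ B ^ D * B ^ C := by gcongr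
    _ = B ^ (D + C) := (pow_add _ _ _).symm
    _ < B ^ (D + C + 1) := pow_lt_pow_right₀ (by linarith) (by omega)
    _ ≤ Real.sqrt M := Real.le_sqrt_of_sq_le hsq
  have hM0 : (0 : ℝ) < M := by linarith
  calc D * (⌊B⌋₊ : ℝ) ^ C * (M : ℝ)⁻¹ < Real.sqrt M * (M : ℝ)⁻¹ := by gcongr
    _ = (M : ℝ) ^ (-(1 / 2) : ℝ) := by
      rw [Real.sqrt_eq_rpow, ← Real.rpow_neg_one, ← Real.rpow_add hM0]
      norm_num
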